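/- arXiv:2209.02194 — 4 statements merged into one kernel-verified Lean document; each statement's English description precedes it below -/
import Mathlib

section
/- Assume there exists β ∈ F such that the sequences {θ_i}_{i=0}^d, {θ*_i}_{i=0}^d, and {ϑ_i}_{i=0}^{d+1} are each β-recurrent, and assume ϑ_1 ≠ ϑ_d. Then for all 0 ≤ i,j ≤ d: E_i A* E_j = 0 if i−j > 1 or 1 < j−i < d; E_i A* E_j ≠ 0 if i−j = 1 or j−i = d; E*_i A E*_j = 0 if i−j > 1 or 1 < j−i < d; and E*_i A E*_j ≠ 0 if i−j = 1 or j−i = d. (That is, (A; {E_i}_{i=0}^d; A*; {E*_i}_{i=0}^d) is a circular Hessenberg system on F^{d+1}.) -/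
open Polynomial Finset

/-- The lower-bidiagonal matrix `A` with diagonal `θ d, θ (d-1), …, θ 0` and all
subdiagonal entries equal to `1`. -/
def matA {F : Type*} [Field F] (d : ℕ) (θ : ℕ → F) :
    Matrix (Fin (d+1)) (Fin (d+1)) F :=
  Matrix.of fun i j =>
    if (i : ℕ) = (j : ℕ) then θ (d - (i : ℕ))
    else if (i : ℕ) = (j : ℕ) + 1 then 1 else 0

/-- The upper-bidiagonal matrix `A*` with diagonal `θs 0, θs 1, …, θs d` and
superdiagonal entries `φ 1, …, φ d`. -/
def matAs {F : Type*} [Field F] (d : ℕ) (θs φ : ℕ → F) :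
    Matrix (Fin (d+1)) (Fin (d+1)) F :=
  Matrix.of fun i j =>
    if (i : ℕ) = (j : ℕ) then θs (i : ℕ)
    else if (j : ℕ) = (i : ℕ) + 1 then φ (j : ℕ) else 0

/-- The primitive idempotent of the matrix `M` for the eigenvalue `θ i`, where the
eigenvalues of `M` are `θ 0, …, θ d`. -/
noncomputable def primIdemM {F : Type*} [Field F] (d : ℕ)
    (M : Matrix (Fin (d+1)) (Fin (d+1)) F) (θ : ℕ → F) (i : ℕ) :
    Matrix (Fin (d+1)) (Fin (d+1)) F :=
  Polynomial.aeval M (∏ j ∈ (Finset.range (d+1)).erase i,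
    (Polynomial.C (θ i - θ j)⁻¹ * (Polynomial.X - Polynomial.C (θ j))))

/-- A sequence `σ 0, …, σ n` is `β`-recurrent. -/
def BetaRecurrent {F : Type*} [Field F] (β : F) (n : ℕ) (σ : ℕ → F) : Prop :=
  ∀ i, 2 ≤ i → i + 1 ≤ n → σ (i-2) - (β+1) * σ (i-1) + (β+1) * σ i - σ (i+1) = 0

/-- The scalars `ϑ`: `ϑ 0 = 0`, `ϑ (d+1) = 0` and
`ϑ i = φ i - (θs i - θs 0)(θ (d-i+1) - θ 0)` for `1 ≤ i ≤ d`. -/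
def vth {F : Type*} [Field F] (d : ℕ) (θ θs φ : ℕ → F) (i : ℕ) : F :=
  if 1 ≤ i ∧ i ≤ d then φ i - (θs i - θs 0) * (θ (d - i + 1) - θ 0) else 0

section Bidiagonal

variable {F : Type*} [Field F] {d : ℕ}

theorem matA_mulVec_apply (θ : ℕ → F) (g : ℤ → F) (hg : g (-1) = 0) (i : Fin (d + 1)) :
    (matA d θ).mulVec (fun j => g j) i = θ (d - i) * g i + g ((i : ℤ) - 1) := by
  obtain ⟨i, hi⟩ := i
  refine (Fin.sum_univ_eq_sum_range (fun j =>
    (if i = j then θ (d - i) else if i = j + 1 then 1 else 0) * g j) (d + 1)).trans ?_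
  rcases i with _ | i
  · rw [Finset.sum_eq_single 0] <;> simp +contextual [hg, eq_comm]
  · rw [Finset.sum_eq_add (i + 1) i (by omega)]
    · simp
    · rintro c - ⟨h1, h2⟩
      rw [if_neg (by omega), if_neg (by omega), zero_mul]
    · intro h; simp at h; omega
    · intro h; simp at h; omega

theorem matAs_mulVec_apply (θs φ : ℕ → F) (g Φ : ℤ → F) (hΦ : ∀ k : ℕ, 1 ≤ k → k ≤ d → Φ k = φ k)
    (hΦd : Φ (d + 1) = 0) (i : Fin (d + 1)) :
    (matAs d θs φ).mulVec (fun j => g j) i =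
      θs i * g i + Φ ((i : ℤ) + 1) * g ((i : ℤ) + 1) := by
  obtain ⟨i, hi⟩ := i
  refine (Fin.sum_univ_eq_sum_range (fun j =>
    (if i = j then θs i else if j = i + 1 then φ j else 0) * g j) (d + 1)).trans ?_
  rcases Nat.lt_succ_iff_lt_or_eq.1 hi with h | rfl
  · have := hΦ (i + 1) (by omega) (by omega)
    push_cast at this
    rw [Finset.sum_eq_add i (i + 1) (by omega)]
    · simp [this]
    · rintro c - ⟨h1, h2⟩
      rw [if_neg (by omega), if_neg (by omega), zero_mul]
    · intro h; simp at h; omega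
    · intro h; simp at h; omega
  · rw [Finset.sum_eq_single i]
    · simp [hΦd]
    · intro b hb hbi
      have := Finset.mem_range.1 hb
      rw [if_neg (by omega), if_neg (by omega), zero_mul]
    · intro h; simp at h

theorem matA_mul_apply_zero (θ : ℕ → F) (M : Matrix (Fin (d + 1)) (Fin (d + 1)) F)
    (j : Fin (d + 1)) : (matA d θ * M) 0 j = θ d * M 0 j := by
  rw [Matrix.mul_apply, Finset.sum_eq_single 0]
  · simp [matA]
  · intro b _ hb
    have : (0 : ℕ) ≠ b := fun h => hb (Fin.ext h.symm)
    simp [matA, this]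
  · simp

theorem matA_mul_apply_succ (θ : ℕ → F) (M : Matrix (Fin (d + 1)) (Fin (d + 1)) F)
    (i : ℕ) (hi : i + 1 < d + 1) (j : Fin (d + 1)) :
    (matA d θ * M) ⟨i + 1, hi⟩ j =
      θ (d - (i + 1)) * M ⟨i + 1, hi⟩ j + M ⟨i, by omega⟩ j := by
  rw [Matrix.mul_apply, Finset.sum_eq_add ⟨i + 1, hi⟩ ⟨i, by omega⟩ (by simp [Fin.ext_iff])]
  · simp [matA]
  · rintro c - ⟨h1, h2⟩
    have h1' : i + 1 ≠ (c : ℕ) := fun h => h1 (Fin.ext h.symm)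
    have h2' : i ≠ (c : ℕ) := fun h => h2 (Fin.ext h.symm)
    simp [matA, h1', h2']
  · simp
  · simp

theorem mul_matA_apply_last (θ : ℕ → F) (M : Matrix (Fin (d + 1)) (Fin (d + 1)) F)
    (i : Fin (d + 1)) : (M * matA d θ) i (Fin.last d) = θ 0 * M i (Fin.last d) := by
  rw [Matrix.mul_apply, Finset.sum_eq_single (Fin.last d)]
  · simp [matA, mul_comm]
  · intro b _ hb
    have : (b : ℕ) ≠ d := fun h => hb (Fin.ext h)
    have h2 : (b : ℕ) ≠ d + 1 := by omega
    simp [matA, this, h2]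
  · simp

theorem mul_matA_apply_of_lt (θ : ℕ → F) (M : Matrix (Fin (d + 1)) (Fin (d + 1)) F)
    (i : Fin (d + 1)) (j : ℕ) (hj : j + 1 < d + 1) :
    (M * matA d θ) i ⟨j, by omega⟩ =
      θ (d - j) * M i ⟨j, by omega⟩ + M i ⟨j + 1, hj⟩ := by
  rw [Matrix.mul_apply, Finset.sum_eq_add ⟨j, by omega⟩ ⟨j + 1, hj⟩ (by simp [Fin.ext_iff])]
  · simp [matA, mul_comm]
  · rintro c - ⟨h1, h2⟩
    have h1' : (c : ℕ) ≠ j := fun h => h1 (Fin.ext h)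
    have h2' : (c : ℕ) ≠ j + 1 := fun h => h2 (Fin.ext h)
    simp [matA, h1', h2']
  · simp
  · simp

theorem mul_matAs_apply_zero (θs φ : ℕ → F) (M : Matrix (Fin (d + 1)) (Fin (d + 1)) F)
    (i : Fin (d + 1)) : (M * matAs d θs φ) i 0 = θs 0 * M i 0 := by
  rw [Matrix.mul_apply, Finset.sum_eq_single 0]
  · simp [matAs, mul_comm]
  · intro b _ hb
    have : (b : ℕ) ≠ 0 := fun h => hb (Fin.ext h)
    simp [matAs, this]
  · simp

theorem mul_matAs_apply_succ (θs φ : ℕ → F) (M : Matrix (Fin (d + 1)) (Fin (d + 1)) F)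
    (i : Fin (d + 1)) (j : ℕ) (hj : j + 1 < d + 1) :
    (M * matAs d θs φ) i ⟨j + 1, hj⟩ =
      θs (j + 1) * M i ⟨j + 1, hj⟩ + φ (j + 1) * M i ⟨j, by omega⟩ := by
  rw [Matrix.mul_apply, Finset.sum_eq_add ⟨j + 1, hj⟩ ⟨j, by omega⟩ (by simp [Fin.ext_iff])]
  · simp [matAs, mul_comm]
  · rintro c - ⟨h1, h2⟩
    have h1' : (c : ℕ) ≠ j + 1 := fun h => h1 (Fin.ext h)
    have h2' : j ≠ (c : ℕ) := fun h => h2 (Fin.ext h.symm)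
    simp [matAs, h1', h2']
  · simp
  · simp

end Bidiagonal

section PrimitiveIdempotent

variable {F : Type*} [Field F] {d : ℕ}

theorem sum_primIdemM (M : Matrix (Fin (d + 1)) (Fin (d + 1)) F) {θ : ℕ → F}
    (hθ : ∀ i ≤ d, ∀ j ≤ d, θ i = θ j → i = j) :
    ∑ i ∈ Finset.range (d + 1), primIdemM d M θ i = 1 := by
  have h := Lagrange.sum_basis (s := Finset.range (d + 1)) (v := θ)
    (fun i hi j hj => hθ i (by simpa [Nat.lt_succ_iff] using hi) j
      (by simpa [Nat.lt_succ_iff] using hj)) ⟨0, by simp⟩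
  have h2 := congrArg (Polynomial.aeval M) h
  rw [map_sum, map_one] at h2
  exact h2

theorem aeval_matA_prod (θ : ℕ → F) :
    Polynomial.aeval (matA d θ) (∏ j ∈ Finset.range (d + 1), (X - C (θ j))) = 0 := by
  have h : (matA d θ).charpoly = ∏ j ∈ Finset.range (d + 1), (X - C (θ j)) := by
    rw [← Matrix.charpoly_transpose, Matrix.charpoly_of_isUpperTriangular]
    · rw [← Finset.prod_range_reflect, ← Fin.prod_univ_eq_prod_range
        (fun j => X - C (θ (d + 1 - 1 - j))) (d + 1)]
      simp [matA]
    · intro i j hij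
      have hij' : (j : ℕ) < i := hij
      have h1 : (j : ℕ) ≠ i := by omega
      have h2 : (j : ℕ) ≠ i + 1 := by omega
      simp [matA, h1, h2]
  rw [← h, Matrix.aeval_self_charpoly]

theorem matA_mul_primIdemM (θ : ℕ → F) {i : ℕ} (hi : i ≤ d) :
    matA d θ * primIdemM d (matA d θ) θ i = θ i • primIdemM d (matA d θ) θ i := by
  have h : Polynomial.aeval (matA d θ) ((X - C (θ i)) *
      ∏ j ∈ (Finset.range (d + 1)).erase i, (C (θ i - θ j)⁻¹ * (X - C (θ j)))) = 0 := by
    rw [Finset.prod_mul_distrib, mul_left_comm,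
      Finset.mul_prod_erase _ (fun j => X - C (θ j)) (Finset.mem_range.2 (Nat.lt_succ_of_le hi)),
      map_mul, aeval_matA_prod, mul_zero]
  rw [map_mul, map_sub, aeval_X, aeval_C, sub_mul, sub_eq_zero, ← Algebra.smul_def] at h
  exact h

theorem primIdemM_mul_matA (θ : ℕ → F) {i : ℕ} (hi : i ≤ d) :
    primIdemM d (matA d θ) θ i * matA d θ = θ i • primIdemM d (matA d θ) θ i := by
  rw [← matA_mul_primIdemM θ hi]
  exact (Algebra.commute_of_mem_adjoin_self (aeval_mem_adjoin_singleton F _)).symm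

theorem primIdemM_apply_eq_zero_of_row {θ : ℕ → F} (hθ : ∀ i ≤ d, ∀ j ≤ d, θ i = θ j → i = j)
    {i : ℕ} (hi : i ≤ d) (k l : Fin (d + 1)) (hk : (k : ℕ) + i < d) :
    primIdemM d (matA d θ) θ i k l = 0 := by
  obtain ⟨k, hk'⟩ := k
  induction k with
  | zero =>
    have h := congrFun (congrFun (matA_mul_primIdemM θ hi) 0) l
    rw [matA_mul_apply_zero, Matrix.smul_apply, smul_eq_mul, mul_eq_mul_right_iff] at h
    refine h.resolve_left fun h => ?_
    have := hθ d le_rfl i hi h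
    simp at hk; omega
  | succ k ih =>
    have h := congrFun (congrFun (matA_mul_primIdemM θ hi) ⟨k + 1, hk'⟩) l
    simp only at hk
    rw [matA_mul_apply_succ, ih (by omega) (by simp only; omega), add_zero, Matrix.smul_apply,
      smul_eq_mul, mul_eq_mul_right_iff] at h
    refine h.resolve_left fun h => ?_
    have := hθ _ (by omega) i hi h
    omega

theorem primIdemM_apply_eq_zero_of_col {θ : ℕ → F} (hθ : ∀ i ≤ d, ∀ j ≤ d, θ i = θ j → i = j)
    {i : ℕ} (hi : i ≤ d) (k l : Fin (d + 1)) (hl : d < (l : ℕ) + i) :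
    primIdemM d (matA d θ) θ i k l = 0 := by
  induction l using Fin.reverseInduction with
  | last =>
    have h := congrFun (congrFun (primIdemM_mul_matA θ hi) k) (Fin.last d)
    rw [mul_matA_apply_last, Matrix.smul_apply, smul_eq_mul, mul_eq_mul_right_iff] at h
    refine h.resolve_left fun h => ?_
    have := hθ 0 (by omega) i hi h
    simp at hl; omega
  | cast l ih =>
    have h := congrFun (congrFun (primIdemM_mul_matA θ hi) k) ⟨l, by omega⟩
    simp only [Fin.val_castSucc] at hl
    have ih' : primIdemM d (matA d θ) θ i k ⟨l + 1, by omega⟩ = 0 :=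
      ih (by simp only [Fin.val_succ]; omega)
    rw [mul_matA_apply_of_lt θ _ k l (by omega), ih', add_zero, Matrix.smul_apply,
      smul_eq_mul, mul_eq_mul_right_iff] at h
    refine h.resolve_left fun h => ?_
    have := hθ _ (by omega) i hi h
    omega

theorem primIdemM_apply_diag {θ : ℕ → F} (hθ : ∀ i ≤ d, ∀ j ≤ d, θ i = θ j → i = j)
    {i : ℕ} (k : Fin (d + 1)) (hk : (k : ℕ) + i = d) :
    primIdemM d (matA d θ) θ i k k = 1 := by
  have h := congrFun (congrFun (sum_primIdemM (matA d θ) hθ) k) k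
  rw [Matrix.sum_apply, Matrix.one_apply_eq, Finset.sum_eq_single i] at h
  · exact h
  · intro j hj hji
    have hj' : j ≤ d := Nat.lt_succ_iff.1 (Finset.mem_range.1 hj)
    rcases lt_or_gt_of_ne hji with h | h
    · exact primIdemM_apply_eq_zero_of_row hθ hj' k k (by omega)
    · exact primIdemM_apply_eq_zero_of_col hθ hj' k k (by omega)
  · intro h
    exact absurd (Finset.mem_range.2 (by omega)) h

theorem primIdemM_mul_of_intertwine {M N P : Matrix (Fin (d + 1)) (Fin (d + 1)) F}
    (h : M * P = P * N) (θ : ℕ → F) (i : ℕ) :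
    primIdemM d M θ i * P = P * primIdemM d N θ i := by
  unfold primIdemM
  generalize ∏ j ∈ (Finset.range (d + 1)).erase i, (C (θ i - θ j)⁻¹ * (X - C (θ j))) = p
  induction p using Polynomial.induction_on' with
  | add p q hp hq => rw [map_add, map_add, add_mul, mul_add, hp, hq]
  | monomial n a =>
    rw [aeval_monomial, aeval_monomial, mul_assoc, ← mul_assoc P, ← Algebra.commutes a P,
      mul_assoc]
    congr 1
    exact (SemiconjBy.pow_right (show SemiconjBy P N M from h.symm) n).eq.symm

end PrimitiveIdempotent

section Recurrence

variable {F : Type*} [Field F]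

theorem BetaRecurrent.sub_eq_const {β : F} {n : ℕ} {σ : ℕ → F} (h : BetaRecurrent β n σ) (k : ℕ)
    (hk : k + 2 ≤ n) : σ k - β * σ (k + 1) + σ (k + 2) = σ 0 - β * σ 1 + σ 2 := by
  induction k with
  | zero => rfl
  | succ k ih =>
    have h1 := h (k + 2) (by omega) (by omega)
    rw [show k + 2 - 2 = k by omega, show k + 2 - 1 = k + 1 by omega] at h1
    rw [← ih (by omega)]
    linear_combination -h1

theorem BetaRecurrent.exists_int_extension {β : F} {n : ℕ} {σ : ℕ → F} (h : BetaRecurrent β n σ) :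
    ∃ (γ : F) (S : ℤ → F), (∀ k : ℕ, k ≤ n → S k = σ k) ∧
      ∀ k, S (k + 1) = β * S k - S (k - 1) + γ := by
  set γ := σ 0 - β * σ 1 + σ 2 with hγ
  let e : Equiv.Perm (F × F) :=
    { toFun := fun p => (p.2, β * p.2 - p.1 + γ)
      invFun := fun p => (β * p.1 - p.2 + γ, p.1)
      left_inv := fun p => by ext <;> simp; ring
      right_inv := fun p => by ext <;> simp; ring }
  have he : ∀ k : ℤ, (e ^ (k + 1)) (σ 0, σ 1) = e ((e ^ k) (σ 0, σ 1)) := fun k => by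
    rw [add_comm, zpow_one_add, Equiv.Perm.mul_apply]
  have hσ : ∀ k : ℕ, k + 1 ≤ n → (e ^ (k : ℤ)) (σ 0, σ 1) = (σ k, σ (k + 1)) := by
    intro k
    induction k with
    | zero => simp
    | succ k ih =>
      intro hk
      rw [Nat.cast_succ, he, ih (by omega)]
      ext
      · rfl
      · change β * σ (k + 1) - σ k + γ = σ (k + 2)
        linear_combination hγ - h.sub_eq_const k hk
  refine ⟨γ, fun k => ((e ^ k) (σ 0, σ 1)).1, fun k hk => ?_, fun k => ?_⟩
  · rcases k with _ | k
    · simp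
    · change ((e ^ ((k + 1 : ℕ) : ℤ)) (σ 0, σ 1)).1 = _
      rw [Nat.cast_succ, he, hσ k hk]
      rfl
  · have h2 := he (k - 1)
    rw [sub_add_cancel] at h2
    dsimp only
    rw [he k, h2]
    rfl

theorem exists_quadratic_invariant {β γ : F} {S : ℤ → F}
    (h : ∀ k, S (k + 1) = β * S k - S (k - 1) + γ) :
    ∃ ρ, ∀ k, S k ^ 2 - β * S k * S (k + 1) + S (k + 1) ^ 2 - γ * (S k + S (k + 1)) - ρ = 0 := by
  refine ⟨S 0 ^ 2 - β * S 0 * S 1 + S 1 ^ 2 - γ * (S 0 + S 1), fun k => ?_⟩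
  have step : ∀ k, S (k - 1) ^ 2 - β * S (k - 1) * S k + S k ^ 2 - γ * (S (k - 1) + S k) =
      S k ^ 2 - β * S k * S (k + 1) + S (k + 1) ^ 2 - γ * (S k + S (k + 1)) := fun k => by
    rw [h k]; ring
  induction k using Int.induction_on with
  | zero => simp
  | succ k ih =>
    have := step (k + 1)
    rw [add_sub_cancel_right] at this
    rw [← this]
    exact ih
  | pred k ih =>
    have := step (-(k : ℤ))
    rw [← this] at ih
    rw [sub_add_cancel]
    exact ih

end Recurrence

section TridiagonalRelation

variable {F : Type*} [Field F]

/-- The two-sided infinite lower-bidiagonal operator with diagonal `t` and subdiagonal `1`. -/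
def lowerOp (t f : ℤ → F) (k : ℤ) : F := t k * f k + f (k - 1)

/-- The two-sided infinite upper-bidiagonal operator with diagonal `s` and superdiagonal `Φ`. -/
def upperOp (s Φ f : ℤ → F) (k : ℤ) : F := s k * f k + Φ (k + 1) * f (k + 1)

/-- `A²B - βABA + BA² - γ(AB + BA) - ρB` for `A = lowerOp t` and `B = upperOp s Φ`. -/
def cubicOp (β γ ρ : F) (t s Φ f : ℤ → F) : ℤ → F :=
  lowerOp t (lowerOp t (upperOp s Φ f)) - β • lowerOp t (upperOp s Φ (lowerOp t f)) +
    upperOp s Φ (lowerOp t (lowerOp t f)) -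
    γ • (lowerOp t (upperOp s Φ f) + upperOp s Φ (lowerOp t f)) - ρ • upperOp s Φ f

theorem cubicOp_apply {β γ γs ρ : F} {t s : ℤ → F} (Φ f : ℤ → F)
    (ht : ∀ k, t (k + 1) = β * t k - t (k - 1) + γ)
    (hs : ∀ k, s (k + 1) = β * s k - s (k - 1) + γs)
    (hρ : ∀ k, t k ^ 2 - β * t k * t (k + 1) + t (k + 1) ^ 2 - γ * (t k + t (k + 1)) - ρ = 0)
    (k : ℤ) :
    cubicOp β γ ρ t s Φ f k =
      (s k * ((2 - β) * t k ^ 2 - 2 * γ * t k - ρ) + Φ k * (t k - t (k + 1)) +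
        Φ (k + 1) * (t k - t (k - 1))) * f k +
      (Φ (k - 1) - β * Φ k + Φ (k + 1) + (t (k - 1) + t k) * (s (k - 1) + s k) -
        β * (t k * s k + t (k - 1) * s (k - 1)) - γ * (s (k - 1) + s k)) * f (k - 1) +
      γs * f (k - 2) := by
  have h1 := ht k
  have h2 := hs (k - 1)
  have h3 := hρ k
  have e1 : k - 1 + 1 = k := by ring
  have e2 : k + 1 - 1 = k := by ring
  have e3 : k - 1 - 1 = k - 2 := by ring
  have e4 : k - 2 + 1 = k - 1 := by ring
  simp only [cubicOp, lowerOp, upperOp, Pi.add_apply, Pi.sub_apply, Pi.smul_apply, smul_eq_mul,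
    e1, e2, e3, e4] at h2 ⊢
  linear_combination (Φ (k + 1) * f (k + 1)) * h3 + (Φ k + Φ (k + 1)) * f k * h1 +
    f (k - 2) * h2

theorem cubicOp_lowerOp {β γ γs γv ρ c e : F} {t s V Φ : ℤ → F} (f : ℤ → F)
    (ht : ∀ k, t (k + 1) = β * t k - t (k - 1) + γ)
    (hs : ∀ k, s (k + 1) = β * s k - s (k - 1) + γs)
    (hV : ∀ k, V (k + 1) = β * V k - V (k - 1) + γv)
    (hρ : ∀ k, t k ^ 2 - β * t k * t (k + 1) + t (k + 1) ^ 2 - γ * (t k + t (k + 1)) - ρ = 0)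
    (hΦ : ∀ k, Φ k = V k + (s k - c) * (t (k - 1) - e)) :
    cubicOp β γ ρ t s Φ (lowerOp t f) = lowerOp t (cubicOp β γ ρ t s Φ f) := by
  ext k
  have ht1 := ht k
  have ht2 := ht (k - 1)
  have ht3 := ht (k - 2)
  have hs1 := hs k
  have hs2 := hs (k - 1)
  have hV1 := hV k
  have hV2 := hV (k - 1)
  have hρ1 := hρ (k - 1)
  have hΦ1 := hΦ (k + 1)
  have hΦ2 := hΦ k
  have hΦ3 := hΦ (k - 1)
  have hΦ4 := hΦ (k - 2)
  have e1 : k - 1 + 1 = k := by ring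
  have e2 : k + 1 - 1 = k := by ring
  have e3 : k - 1 - 1 = k - 2 := by ring
  have e4 : k - 2 + 1 = k - 1 := by ring
  have e5 : k - 2 - 1 = k - 3 := by ring
  have e6 : k - 1 - 2 = k - 3 := by ring
  simp only [lowerOp, cubicOp_apply Φ _ ht hs hρ, e1, e2, e3, e4, e5, e6] at *
  have hd1 : (t k - t (k - 1)) * (Φ (k - 1) - β * Φ k + Φ (k + 1) +
        (t (k - 1) + t k) * (s (k - 1) + s k) -
        β * (t k * s k + t (k - 1) * s (k - 1)) - γ * (s (k - 1) + s k)) +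
      (s (k - 1) * ((2 - β) * t (k - 1) ^ 2 - 2 * γ * t (k - 1) - ρ) +
        Φ (k - 1) * (t (k - 1) - t k) + Φ k * (t (k - 1) - t (k - 2))) -
      (s k * ((2 - β) * t k ^ 2 - 2 * γ * t k - ρ) + Φ k * (t k - t (k + 1)) +
        Φ (k + 1) * (t k - t (k - 1))) = 0 := by
    linear_combination (s (k - 1) - s k) * hρ1 + Φ k * (ht1 - ht2)
  have ht4 : t (k - 3) = β * t (k - 2) - t (k - 1) + γ := by linear_combination ht3
  have hs3 : s (k - 2) = β * s (k - 1) - s k + γs := by linear_combination hs2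
  have hd2 : Φ (k - 1) - β * Φ k + Φ (k + 1) + (t (k - 1) + t k) * (s (k - 1) + s k) -
        β * (t k * s k + t (k - 1) * s (k - 1)) - γ * (s (k - 1) + s k) -
      (Φ (k - 2) - β * Φ (k - 1) + Φ k + (t (k - 2) + t (k - 1)) * (s (k - 2) + s (k - 1)) -
        β * (t (k - 1) * s (k - 1) + t (k - 2) * s (k - 2)) - γ * (s (k - 2) + s (k - 1))) -
      γs * (t k - t (k - 2)) = 0 := by
    rw [hΦ1, hΦ2, hΦ3, hΦ4, ht4, hs3, ht2, hs1, hV1, hV2]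
    ring
  linear_combination f (k - 2) * hd2 - f (k - 1) * hd1

end TridiagonalRelation

section Restriction

variable {F : Type*} [Field F] {d : ℕ}

/-- The two-sided sequence `g` is supported on the nonnegative integers, and restricts to `f` on
`0, …, d`. -/
def Restricts (f : Fin (d + 1) → F) (g : ℤ → F) : Prop :=
  (∀ i : Fin (d + 1), g (i : ℕ) = f i) ∧ ∀ k < 0, g k = 0

theorem exists_restricts (f : Fin (d + 1) → F) : ∃ g, Restricts f g := by
  refine ⟨fun k => if h : 0 ≤ k ∧ k.toNat < d + 1 then f ⟨k.toNat, h.2⟩ else 0, fun i => ?_,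
    fun k hk => ?_⟩
  · simp only [Int.toNat_natCast]
    rw [dif_pos ⟨by omega, i.2⟩]
  · exact dif_neg fun h => by omega

namespace Restricts

variable {f f' : Fin (d + 1) → F} {g g' : ℤ → F}

theorem add (h : Restricts f g) (h' : Restricts f' g') : Restricts (f + f') (g + g') :=
  ⟨fun i => by simp [h.1, h'.1], fun k hk => by simp [h.2 k hk, h'.2 k hk]⟩

theorem sub (h : Restricts f g) (h' : Restricts f' g') : Restricts (f - f') (g - g') :=
  ⟨fun i => by simp [h.1, h'.1], fun k hk => by simp [h.2 k hk, h'.2 k hk]⟩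

theorem smul (c : F) (h : Restricts f g) : Restricts (c • f) (c • g) :=
  ⟨fun i => by simp [h.1], fun k hk => by simp [h.2 k hk]⟩

theorem eq (h : Restricts f g) (h' : Restricts f' g) : f = f' :=
  funext fun i => (h.1 i).symm.trans (h'.1 i)

theorem matA_mulVec {θ : ℕ → F} {t : ℤ → F} (ht : ∀ k : ℕ, k ≤ d → t k = θ (d - k))
    (h : Restricts f g) : Restricts ((matA d θ).mulVec f) (lowerOp t g) := by
  refine ⟨fun i => ?_, fun k hk => ?_⟩
  · rw [← funext h.1, matA_mulVec_apply θ g (h.2 _ (by omega)), lowerOp, ht i (by omega)]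
  · rw [lowerOp, h.2 k hk, h.2 _ (by omega), mul_zero, add_zero]

theorem matAs_mulVec {θs φ : ℕ → F} {s Φ : ℤ → F} (hs : ∀ k : ℕ, k ≤ d → s k = θs k)
    (hΦ0 : Φ 0 = 0) (hΦ : ∀ k : ℕ, 1 ≤ k → k ≤ d → Φ k = φ k) (hΦd : Φ (d + 1) = 0)
    (h : Restricts f g) : Restricts ((matAs d θs φ).mulVec f) (upperOp s Φ g) := by
  refine ⟨fun i => ?_, fun k hk => ?_⟩
  · rw [← funext h.1, matAs_mulVec_apply θs φ g Φ hΦ hΦd, upperOp, hs i (by omega)]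
  · rw [upperOp, h.2 k hk, mul_zero, zero_add]
    rcases eq_or_ne k (-1) with rfl | hk'
    · simp [hΦ0]
    · rw [h.2 (k + 1) (by omega), mul_zero]

end Restricts

/-- `A²B - βABA + BA² - γ(AB + BA) - ρB`. -/
def cubicExpr (β γ ρ : F) (A B : Matrix (Fin (d + 1)) (Fin (d + 1)) F) :
    Matrix (Fin (d + 1)) (Fin (d + 1)) F :=
  A * (A * B) - β • (A * (B * A)) + B * (A * A) - γ • (A * B + B * A) - ρ • B

theorem exists_commute_cubicExpr {θ θs φ : ℕ → F} {β : F} (hθ : BetaRecurrent β d θ)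
    (hθs : BetaRecurrent β d θs) (hv : BetaRecurrent β (d + 1) (vth d θ θs φ)) :
    ∃ γ ρ : F, (∀ k, k + 2 ≤ d → θ k - β * θ (k + 1) + θ (k + 2) = γ) ∧
      (∀ k, k + 1 ≤ d → θ k ^ 2 - β * θ k * θ (k + 1) + θ (k + 1) ^ 2 -
        γ * (θ k + θ (k + 1)) - ρ = 0) ∧
      cubicExpr β γ ρ (matA d θ) (matAs d θs φ) * matA d θ =
        matA d θ * cubicExpr β γ ρ (matA d θ) (matAs d θs φ) := by
  obtain ⟨γ, T, hT, hTr⟩ := hθ.exists_int_extension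
  obtain ⟨γs, S, hS, hSr⟩ := hθs.exists_int_extension
  obtain ⟨γv, V, hV, hVr⟩ := hv.exists_int_extension
  obtain ⟨ρ, hρ⟩ := exists_quadratic_invariant hTr
  refine ⟨γ, ρ, fun k hk => ?_, fun k hk => ?_, ?_⟩
  · have h := hTr (k + 1)
    rw [show (k : ℤ) + 1 + 1 = (k + 2 : ℕ) by push_cast; ring, add_sub_cancel_right,
      ← Nat.cast_succ, hT _ hk, hT _ (by omega), hT _ (by omega)] at h
    rw [h]; ring
  · have h := hρ k
    rwa [← Nat.cast_succ, hT _ hk, hT _ (by omega)] at h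
  set t : ℤ → F := fun k => T (d - k) with ht
  set Φ : ℤ → F := fun k => V k + (S k - S 0) * (t (k - 1) - T 0) with hΦ
  have htr : ∀ k, t (k + 1) = β * t k - t (k - 1) + γ := fun k => by
    have h := hTr (d - k)
    simp only [ht]
    rw [show (d : ℤ) - (k + 1) = d - k - 1 by ring, show (d : ℤ) - (k - 1) = d - k + 1 by ring, h]
    ring
  have htρ : ∀ k, t k ^ 2 - β * t k * t (k + 1) + t (k + 1) ^ 2 -
      γ * (t k + t (k + 1)) - ρ = 0 := fun k => by
    have h := hρ (d - (k + 1))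
    rw [show (d : ℤ) - (k + 1) + 1 = d - k by ring] at h
    rw [← h]; ring
  have htθ : ∀ k : ℕ, k ≤ d → t k = θ (d - k) := fun k hk => by
    rw [← hT _ (by omega), Nat.cast_sub hk]
  have hV0 : V 0 = 0 := by
    have := hV 0 (by omega)
    simpa [vth] using this
  have hVd : V (d + 1) = 0 := by
    have := hV (d + 1) le_rfl
    simpa [vth] using this
  have hΦ0 : Φ 0 = 0 := by simp [hΦ, hV0]
  have hΦd : Φ (d + 1) = 0 := by simp [hΦ, hVd, ht]
  have hΦφ : ∀ k : ℕ, 1 ≤ k → k ≤ d → Φ k = φ k := fun k hk hkd => by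
    have h0 := hS 0 (by omega)
    have h0' := hT 0 (by omega)
    rw [Nat.cast_zero] at h0 h0'
    simp only [hΦ]
    rw [hV k (by omega), hS k hkd, h0, h0', ← Nat.cast_pred hk, htθ _ (by omega), vth,
      if_pos ⟨hk, hkd⟩, show d - (k - 1) = d - k + 1 by omega]
    ring
  have hA : ∀ {f : Fin (d + 1) → F} {g : ℤ → F}, Restricts f g →
    Restricts ((matA d θ).mulVec f) (lowerOp t g) := fun h => h.matA_mulVec htθ
  have hB : ∀ {f : Fin (d + 1) → F} {g : ℤ → F}, Restricts f g →
    Restricts ((matAs d θs φ).mulVec f) (upperOp S Φ g) :=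
      fun h => h.matAs_mulVec hS hΦ0 hΦφ hΦd
  have hX : ∀ {f : Fin (d + 1) → F} {g : ℤ → F}, Restricts f g →
      Restricts ((cubicExpr β γ ρ (matA d θ) (matAs d θs φ)).mulVec f)
        (cubicOp β γ ρ t S Φ g) := fun h => by
    simp only [cubicExpr, Matrix.sub_mulVec, Matrix.add_mulVec, Matrix.smul_mulVec,
      ← Matrix.mulVec_mulVec]
    exact (((((hA (hA (hB h))).sub ((hA (hB (hA h))).smul β)).add (hB (hA (hA h)))).sub
      (((hA (hB h)).add (hB (hA h))).smul γ))).sub ((hB h).smul ρ)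
  refine Matrix.ext_of_mulVec_single fun i => ?_
  obtain ⟨g, hg⟩ := exists_restricts (Pi.single i (1 : F))
  rw [← Matrix.mulVec_mulVec, ← Matrix.mulVec_mulVec]
  refine (hX (hA hg)).eq ?_
  rw [cubicOp_lowerOp g htr hSr hVr htρ fun k => rfl]
  exact hA (hX hg)

end Restriction

section HalfSystem

variable {F : Type*} [Field F] {d : ℕ}

theorem primIdemM_mul_matAs_mul_eq_zero_of_lt {θ : ℕ → F} (θs φ : ℕ → F)
    (hθ : ∀ i ≤ d, ∀ j ≤ d, θ i = θ j → i = j) {i j : ℕ} (hi : i ≤ d) (hj : j ≤ d)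
    (hij : j + 1 < i) :
    primIdemM d (matA d θ) θ i * matAs d θs φ * primIdemM d (matA d θ) θ j = 0 := by
  ext a b
  rw [mul_assoc, Matrix.mul_apply, Matrix.zero_apply]
  refine Finset.sum_eq_zero fun k _ => ?_
  rcases lt_or_ge d ((k : ℕ) + i) with hk | hk
  · rw [primIdemM_apply_eq_zero_of_col hθ hi a k hk, zero_mul]
  · rw [Matrix.mul_apply, Finset.sum_eq_zero fun l _ => ?_, mul_zero]
    rcases lt_or_ge ((l : ℕ) + j) d with hl | hl
    · rw [primIdemM_apply_eq_zero_of_row hθ hj l b hl, mul_zero]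
    · have h1 : (k : ℕ) ≠ l := by omega
      have h2 : (l : ℕ) ≠ k + 1 := by omega
      simp [matAs, h1, h2]

theorem primIdemM_succ_mul_matAs_mul_ne_zero {θ φ : ℕ → F} (θs : ℕ → F)
    (hθ : ∀ i ≤ d, ∀ j ≤ d, θ i = θ j → i = j) (hφ : ∀ i, 1 ≤ i → i ≤ d → φ i ≠ 0)
    {j : ℕ} (hj : j + 1 ≤ d) :
    primIdemM d (matA d θ) θ (j + 1) * matAs d θs φ * primIdemM d (matA d θ) θ j ≠ 0 := by
  intro h
  set a : Fin (d + 1) := ⟨d - (j + 1), by omega⟩ with ha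
  set b : Fin (d + 1) := ⟨d - j, by omega⟩ with hb
  have h := congrFun (congrFun h a) b
  have hab : matAs d θs φ a b = φ (d - j) := by
    have h1 : d - (j + 1) ≠ d - j := by omega
    have h2 : d - j = d - (j + 1) + 1 := by omega
    simp only [matAs, Matrix.of_apply, ha, hb]
    rw [if_neg h1, if_pos h2]
  rw [mul_assoc, Matrix.mul_apply, Finset.sum_eq_single a, Matrix.mul_apply,
    Finset.sum_eq_single b, primIdemM_apply_diag hθ a (by simp only [ha]; omega),
    primIdemM_apply_diag hθ b (by simp only [hb]; omega), hab, one_mul, mul_one] at h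
  · exact hφ _ (by omega) (by omega) h
  · intro l _ hl
    have hl' : (l : ℕ) ≠ d - j := fun h => hl (Fin.ext h)
    rcases lt_or_ge ((l : ℕ) + j) d with hlj | hlj
    · rw [primIdemM_apply_eq_zero_of_row hθ (by omega) l b hlj, mul_zero]
    · have h1 : d - (j + 1) ≠ (l : ℕ) := by omega
      have h2 : (l : ℕ) ≠ d - (j + 1) + 1 := by omega
      simp [matAs, ha, h1, h2]
  · simp
  · intro k _ hk
    have hk' : (k : ℕ) ≠ d - (j + 1) := fun h => hk (Fin.ext h)
    rcases lt_or_ge d ((k : ℕ) + (j + 1)) with hkj | hkj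
    · rw [primIdemM_apply_eq_zero_of_col hθ (by omega) a k hkj, zero_mul]
    · rw [Matrix.mul_apply, Finset.sum_eq_zero fun l _ => ?_, mul_zero]
      rcases lt_or_ge ((l : ℕ) + j) d with hlj | hlj
      · rw [primIdemM_apply_eq_zero_of_row hθ (by omega) l b hlj, mul_zero]
      · have h1 : (k : ℕ) ≠ l := by omega
        have h2 : (l : ℕ) ≠ k + 1 := by omega
        simp [matAs, h1, h2]
  · simp

theorem primIdemM_mul_cubicExpr_mul (θ : ℕ → F) (B : Matrix (Fin (d + 1)) (Fin (d + 1)) F)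
    (β γ ρ : F) {i j : ℕ} (hi : i ≤ d) (hj : j ≤ d) :
    primIdemM d (matA d θ) θ i * cubicExpr β γ ρ (matA d θ) B * primIdemM d (matA d θ) θ j =
      (θ i ^ 2 - β * θ i * θ j + θ j ^ 2 - γ * (θ i + θ j) - ρ) •
        (primIdemM d (matA d θ) θ i * B * primIdemM d (matA d θ) θ j) := by
  have h1 := primIdemM_mul_matA θ hi
  have h2 := matA_mul_primIdemM θ hj
  have h3 : ∀ Y, primIdemM d (matA d θ) θ i * (matA d θ * Y) =
      θ i • (primIdemM d (matA d θ) θ i * Y) := fun Y => by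
    rw [← mul_assoc, h1, smul_mul_assoc]
  simp only [cubicExpr, mul_add, mul_sub, add_mul, sub_mul, mul_assoc, smul_mul_assoc,
    mul_smul_comm, h2, h3]
  module

theorem primIdemM_mul_matAs_mul_eq_zero_of_gt {θ θs φ : ℕ → F} {β : F}
    (hθ : ∀ i ≤ d, ∀ j ≤ d, θ i = θ j → i = j) (hrθ : BetaRecurrent β d θ)
    (hrθs : BetaRecurrent β d θs) (hv : BetaRecurrent β (d + 1) (vth d θ θs φ))
    {i j : ℕ} (hj : j ≤ d) (hij : i + 1 < j) (hijd : j < i + d) :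
    primIdemM d (matA d θ) θ i * matAs d θs φ * primIdemM d (matA d θ) θ j = 0 := by
  obtain ⟨γ, ρ, hγ, hρ, hX⟩ := exists_commute_cubicExpr hrθ hrθs hv
  have hi : i ≤ d := by omega
  have hne : ∀ {a b : ℕ}, a ≤ d → b ≤ d → a ≠ b → θ a - θ b ≠ 0 := fun ha hb hab h =>
    hab (hθ _ ha _ hb (sub_eq_zero.1 h))
  have h := congrArg (fun M => primIdemM d (matA d θ) θ i * M * primIdemM d (matA d θ) θ j) hX
  rw [← mul_assoc, mul_assoc _ (matA d θ), matA_mul_primIdemM θ hj, ← mul_assoc,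
    primIdemM_mul_matA θ hi, mul_smul_comm, smul_mul_assoc, smul_mul_assoc, ← sub_eq_zero,
    ← sub_smul, primIdemM_mul_cubicExpr_mul θ _ β γ ρ hi hj, smul_smul, smul_eq_zero] at h
  refine h.resolve_left (mul_ne_zero (hne hj hi (by omega)) ?_)
  have hfactor : ∀ k x, k + 2 ≤ d →
      θ (k + 1) ^ 2 - β * θ (k + 1) * x + x ^ 2 - γ * (θ (k + 1) + x) - ρ =
        (x - θ k) * (x - θ (k + 2)) := fun k x hk => by
    linear_combination (x - θ k) * hγ k hk + hρ k (by omega)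
  rcases i with _ | i
  · obtain ⟨k, rfl⟩ : ∃ k, j = k + 1 := ⟨j - 1, by omega⟩
    have h1 := hfactor k (θ 0) (by omega)
    have h2 := mul_ne_zero (hne (Nat.zero_le d) (show k ≤ d by omega) (by omega))
      (hne (Nat.zero_le d) (show k + 2 ≤ d by omega) (by omega))
    rw [← h1] at h2
    intro h3
    exact h2 (by rw [← h3]; ring)
  · rw [hfactor i (θ j) (by omega)]
    exact mul_ne_zero (hne hj (by omega) (by omega)) (hne hj (by omega) (by omega))

theorem primIdemM_zero_mul_matAs_mul_last_ne_zero {θ θs φ : ℕ → F} {β : F} (hd : 3 ≤ d)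
    (hθ : ∀ i ≤ d, ∀ j ≤ d, θ i = θ j → i = j) (hrθ : BetaRecurrent β d θ)
    (hrθs : BetaRecurrent β d θs) (hv : BetaRecurrent β (d + 1) (vth d θ θs φ))
    (hvth : vth d θ θs φ 1 ≠ vth d θ θs φ d) :
    primIdemM d (matA d θ) θ 0 * matAs d θs φ * primIdemM d (matA d θ) θ d ≠ 0 := by
  intro h0
  set A := matA d θ
  set B := matAs d θs φ
  set E := primIdemM d A θ
  have hAE : ∀ i ≤ d, E i * A = θ i • E i := fun i hi => primIdemM_mul_matA θ hi
  have hsum : E 0 * B = E 0 * B * E 0 + E 0 * B * E 1 := by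
    conv_lhs => rw [← mul_one (E 0 * B), ← sum_primIdemM A hθ, Finset.mul_sum]
    rw [Finset.sum_eq_add 0 1 (by omega)]
    · rintro j hj ⟨hj0, hj1⟩
      have hj' : j ≤ d := Nat.lt_succ_iff.1 (Finset.mem_range.1 hj)
      rcases eq_or_ne j d with rfl | hjd
      · exact h0
      · exact primIdemM_mul_matAs_mul_eq_zero_of_gt hθ hrθ hrθs hv hj' (by omega) (by omega)
    · simp
    · intro h; simp at h; omega
  have hkey : E 0 * B * A - θ 0 • (E 0 * B) =
      (θ 1 - θ 0) • (E 0 * B - E 0 * B * E 0) := by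
    have h1 : E 0 * B * E 1 = E 0 * B - E 0 * B * E 0 := eq_sub_of_add_eq' hsum.symm
    have h2 : E 0 * B * A = θ 0 • (E 0 * B * E 0) + θ 1 • (E 0 * B * E 1) := by
      conv_lhs => rw [hsum, add_mul, mul_assoc (E 0 * B), mul_assoc (E 0 * B),
        hAE 0 (by omega), hAE 1 (by omega), mul_smul_comm, mul_smul_comm]
    rw [h2, h1]
    module
  obtain ⟨n, rfl⟩ : ∃ n, d = n + 1 := ⟨d - 1, by omega⟩
  set w : Fin (n + 1 + 1) → F := E 0 (Fin.last (n + 1))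
  have hstep : ∀ (l : ℕ) (hl : l + 1 < n + 1 + 1), θ (n + 1 - l) * w ⟨l, by omega⟩ +
      w ⟨l + 1, hl⟩ = θ 0 * w ⟨l, by omega⟩ := fun l hl => by
    have h := congrFun (congrFun (hAE 0 (by omega)) (Fin.last (n + 1))) ⟨l, by omega⟩
    rwa [mul_matA_apply_of_lt θ _ _ l hl] at h
  have hw1 : w (Fin.last (n + 1)) = 1 := primIdemM_apply_diag hθ _ (by simp)
  have hw0 : w 0 ≠ 0 := fun h0 => by
    have hall : ∀ (l : ℕ) (hl : l < n + 1 + 1), w ⟨l, hl⟩ = 0 := by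
      intro l
      induction l with
      | zero => exact fun _ => h0
      | succ l ih =>
        intro hl
        have h := hstep l hl
        rwa [ih (by omega), mul_zero, mul_zero, zero_add] at h
    exact one_ne_zero (hw1.symm.trans (hall (n + 1) (by omega)))
  have hB0 : (E 0 * B) (Fin.last (n + 1)) 0 = θs 0 * w 0 := mul_matAs_apply_zero θs φ _ _
  have hB1 : (E 0 * B) (Fin.last (n + 1)) ⟨0 + 1, by omega⟩ =
      θs 1 * w ⟨0 + 1, by omega⟩ + φ 1 * w 0 := mul_matAs_apply_succ θs φ _ _ 0 (by omega)
  have hBd : (E 0 * B) (Fin.last (n + 1)) (Fin.last (n + 1)) =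
      θs (n + 1) * w (Fin.last (n + 1)) + φ (n + 1) * w ⟨n, by omega⟩ :=
    mul_matAs_apply_succ θs φ _ _ n (by omega)
  have hBA : (E 0 * B * A) (Fin.last (n + 1)) 0 =
      θ (n + 1) * (E 0 * B) (Fin.last (n + 1)) 0 +
        (E 0 * B) (Fin.last (n + 1)) ⟨0 + 1, by omega⟩ :=
    mul_matA_apply_of_lt θ _ _ 0 (by omega)
  have hBE : (E 0 * B * E 0) (Fin.last (n + 1)) 0 =
      (E 0 * B) (Fin.last (n + 1)) (Fin.last (n + 1)) * w 0 := by
    rw [Matrix.mul_apply, Finset.sum_eq_single (Fin.last (n + 1))]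
    · intro k _ hk
      have hk' : (k : ℕ) ≠ n + 1 := fun h => hk (Fin.ext h)
      have hz : E 0 k 0 = 0 := primIdemM_apply_eq_zero_of_row hθ (by omega) k 0 (by omega)
      rw [hz, mul_zero]
    · simp
  have h := congrFun (congrFun hkey (Fin.last (n + 1))) 0
  simp only [Matrix.sub_apply, Matrix.smul_apply, smul_eq_mul] at h
  rw [hBA, hBE, hB0, hB1, hBd, hw1] at h
  have hs0 : θ (n + 1) * w 0 + w ⟨0 + 1, by omega⟩ = θ 0 * w 0 := hstep 0 (by omega)
  have hsn := hstep n (by omega)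
  rw [show (⟨n + 1, by omega⟩ : Fin (n + 1 + 1)) = Fin.last (n + 1) from rfl, hw1,
    show n + 1 - n = 1 by omega] at hsn
  refine hvth (mul_right_cancel₀ hw0 ?_)
  rw [vth, vth, if_pos (by omega), if_pos (by omega), show n + 1 - 1 + 1 = n + 1 by omega,
    show n + 1 - (n + 1) + 1 = 1 by omega]
  linear_combination h - θs 1 * hs0 - φ (n + 1) * w 0 * hsn

theorem circular_hessenberg_half {θ θs φ : ℕ → F} {β : F} (hd : 3 ≤ d)
    (hθ : ∀ i ≤ d, ∀ j ≤ d, θ i = θ j → i = j) (hφ : ∀ i, 1 ≤ i → i ≤ d → φ i ≠ 0)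
    (hrθ : BetaRecurrent β d θ) (hrθs : BetaRecurrent β d θs)
    (hv : BetaRecurrent β (d + 1) (vth d θ θs φ))
    (hvth : vth d θ θs φ 1 ≠ vth d θ θs φ d) :
    (∀ i ≤ d, ∀ j ≤ d,
      ((j : ℤ) + 1 < (i : ℤ) ∨ (1 < (j : ℤ) - (i : ℤ) ∧ (j : ℤ) - (i : ℤ) < (d : ℤ))) →
      primIdemM d (matA d θ) θ i * matAs d θs φ * primIdemM d (matA d θ) θ j = 0) ∧
    (∀ i ≤ d, ∀ j ≤ d,
      ((i : ℤ) = (j : ℤ) + 1 ∨ (j : ℤ) = (i : ℤ) + (d : ℤ)) →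
      primIdemM d (matA d θ) θ i * matAs d θs φ * primIdemM d (matA d θ) θ j ≠ 0) := by
  refine ⟨fun i hi j hj hij => ?_, fun i hi j hj hij => ?_⟩
  · rcases hij with hij | ⟨hij, hijd⟩
    · exact primIdemM_mul_matAs_mul_eq_zero_of_lt θs φ hθ hi hj (by omega)
    · exact primIdemM_mul_matAs_mul_eq_zero_of_gt hθ hrθ hrθs hv hj (by omega) (by omega)
  · rcases hij with hij | hij
    · obtain rfl : i = j + 1 := by omega
      exact primIdemM_succ_mul_matAs_mul_ne_zero θs hθ hφ hi
    · obtain rfl : i = 0 := by omega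
      obtain rfl : j = d := by omega
      exact primIdemM_zero_mul_matAs_mul_last_ne_zero hd hθ hrθ hrθs hv hvth

end HalfSystem

section Duality

variable {F : Type*} [Field F] {d : ℕ}

/-- The antidiagonal matrix carrying the split form of `(A*, A)` to that of `(A, A*)`. -/
def dualityMatrix (d : ℕ) (φ : ℕ → F) : Matrix (Fin (d + 1)) (Fin (d + 1)) F :=
  Matrix.of fun i j =>
    if (i : ℕ) + j = d then ∏ k ∈ Finset.range j, φ (d - k) else 0

theorem matAs_mul_dualityMatrix (θs φ : ℕ → F) :
    matAs d θs φ * dualityMatrix d φ = dualityMatrix d φ * matA d θs := by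
  ext i j
  rw [Matrix.mul_apply, Matrix.mul_apply, Finset.sum_eq_single j.rev,
    Finset.sum_eq_single i.rev]
  · have hi := i.2
    have hj := j.2
    have e1 : d - (j : ℕ) + j = d := by omega
    have e2 : (i : ℕ) + (d - i) = d := by omega
    simp only [matAs, matA, dualityMatrix, Matrix.of_apply, Fin.val_rev, Nat.add_sub_add_right,
      e1, e2, if_true]
    by_cases h1 : (i : ℕ) + j = d
    · rw [if_pos (by omega), if_pos (by omega), show d - (d - (i : ℕ)) = i by omega,
        show d - (i : ℕ) = j by omega, mul_comm]
    · rw [if_neg (show ¬ (i : ℕ) = d - j by omega), if_neg (show ¬ d - (i : ℕ) = j by omega)]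
      by_cases h2 : (i : ℕ) + j + 1 = d
      · rw [if_pos (by omega), if_pos (by omega), show d - (i : ℕ) = j + 1 by omega,
          Finset.prod_range_succ, mul_one, mul_comm]
      · rw [if_neg (by omega), if_neg (by omega), zero_mul, mul_zero]
  · intro k _ hk
    have : ¬ (i : ℕ) + k = d := fun h => hk (Fin.ext (by rw [Fin.val_rev]; omega))
    simp [dualityMatrix, this]
  · simp
  · intro k _ hk
    have : ¬ (k : ℕ) + j = d := fun h => hk (Fin.ext (by rw [Fin.val_rev]; omega))
    simp [dualityMatrix, this]
  · simp

theorem matA_mul_dualityMatrix (θ φ : ℕ → F) :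
    matA d θ * dualityMatrix d φ =
      dualityMatrix d φ * matAs d θ (fun i => φ (d - i + 1)) := by
  ext i j
  rw [Matrix.mul_apply, Matrix.mul_apply, Finset.sum_eq_single j.rev,
    Finset.sum_eq_single i.rev]
  · have hi := i.2
    have hj := j.2
    have e1 : d - (j : ℕ) + j = d := by omega
    have e2 : (i : ℕ) + (d - i) = d := by omega
    simp only [matAs, matA, dualityMatrix, Matrix.of_apply, Fin.val_rev, Nat.add_sub_add_right,
      e1, e2, if_true]
    by_cases h1 : (i : ℕ) + j = d
    · rw [if_pos (by omega), if_pos (by omega), show d - (i : ℕ) = j by omega, mul_comm]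
    · rw [if_neg (show ¬ (i : ℕ) = d - j by omega), if_neg (show ¬ d - (i : ℕ) = j by omega)]
      by_cases h2 : (i : ℕ) + j = d + 1
      · rw [if_pos (by omega), if_pos (by omega), one_mul,
          show (j : ℕ) = d - i + 1 by omega, Finset.prod_range_succ,
          show d - (d - (i : ℕ) + 1) + 1 = d - (d - i) by omega]
      · rw [if_neg (by omega), if_neg (by omega), zero_mul, mul_zero]
  · intro k _ hk
    have : ¬ (i : ℕ) + k = d := fun h => hk (Fin.ext (by rw [Fin.val_rev]; omega))
    simp [dualityMatrix, this]
  · simp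
  · intro k _ hk
    have : ¬ (k : ℕ) + j = d := fun h => hk (Fin.ext (by rw [Fin.val_rev]; omega))
    simp [dualityMatrix, this]
  · simp

theorem isUnit_dualityMatrix {φ : ℕ → F} (hφ : ∀ i, 1 ≤ i → i ≤ d → φ i ≠ 0) :
    IsUnit (dualityMatrix d φ) := by
  have hc : ∀ j : Fin (d + 1), ∏ k ∈ Finset.range j, φ (d - k) ≠ 0 := fun j =>
    Finset.prod_ne_zero_iff.2 fun k hk => by
      have := Finset.mem_range.1 hk
      exact hφ _ (by omega) (by omega)
  refine Matrix.mulVec_injective_iff_isUnit.1 fun v w hvw => funext fun j => ?_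
  have hmul : ∀ u : Fin (d + 1) → F, (dualityMatrix d φ).mulVec u j.rev =
      (∏ k ∈ Finset.range j, φ (d - k)) * u j := fun u => by
    rw [Matrix.mulVec, dotProduct, Finset.sum_eq_single j]
    · have : d - (j : ℕ) + j = d := by omega
      simp [dualityMatrix, Fin.val_rev, this]
    · intro k _ hk
      have : ¬ d - (j : ℕ) + k = d := fun h => hk (Fin.ext (by omega))
      simp [dualityMatrix, Fin.val_rev, this]
    · simp
  have h := congrFun hvw j.rev
  rw [hmul, hmul] at h
  exact mul_left_cancel₀ (hc j) h

theorem vth_dual (θ θs φ : ℕ → F) {i : ℕ} (hi : i ≤ d + 1) :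
    vth d θs θ (fun i => φ (d - i + 1)) i = vth d θ θs φ (d + 1 - i) := by
  unfold vth
  by_cases h : 1 ≤ i ∧ i ≤ d
  · rw [if_pos h, if_pos (by omega), show d + 1 - i = d - i + 1 by omega,
      show d - (d - i + 1) + 1 = i by omega, mul_comm]
  · rw [if_neg h, if_neg (by omega)]

theorem BetaRecurrent.vth_dual {β : F} {θ θs φ : ℕ → F}
    (h : BetaRecurrent β (d + 1) (vth d θ θs φ)) :
    BetaRecurrent β (d + 1) (vth d θs θ (fun i => φ (d - i + 1))) := by
  intro i h2 hi
  have h := h (d + 1 - i + 1) (by omega) (by omega)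
  rw [_root_.vth_dual _ _ _ (by omega), _root_.vth_dual _ _ _ (by omega),
    _root_.vth_dual _ _ _ (by omega), _root_.vth_dual _ _ _ (by omega)]
  rw [show d + 1 - i + 1 - 2 = d + 1 - (i + 1) by omega,
    show d + 1 - i + 1 - 1 = d + 1 - i by omega, show d + 1 - i + 1 = d + 1 - (i - 1) by omega,
    show d + 1 - (i - 1) + 1 = d + 1 - (i - 2) by omega] at h
  linear_combination -h

end Duality

/-- under the recurrence hypotheses and `ϑ 1 ≠ ϑ d`, the sequence
`(A; {E i}; A*; {E* i})` is a circular Hessenberg system on `F^(d+1)`. -/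
theorem stmt0 {F : Type*} [Field F]
    (d : ℕ) (hd : 3 ≤ d)
    (θ θs φ : ℕ → F)
    (hθ : ∀ i ≤ d, ∀ j ≤ d, θ i = θ j → i = j)
    (hθs : ∀ i ≤ d, ∀ j ≤ d, θs i = θs j → i = j)
    (hφ : ∀ i, 1 ≤ i → i ≤ d → φ i ≠ 0)
    (hrec : ∃ β : F, BetaRecurrent β d θ ∧ BetaRecurrent β d θs ∧
      BetaRecurrent β (d+1) (vth d θ θs φ))
    (hvth : vth d θ θs φ 1 ≠ vth d θ θs φ d) :
    (∀ i ≤ d, ∀ j ≤ d,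
      ((j : ℤ) + 1 < (i : ℤ) ∨ (1 < (j : ℤ) - (i : ℤ) ∧ (j : ℤ) - (i : ℤ) < (d : ℤ))) →
      primIdemM d (matA d θ) θ i * matAs d θs φ * primIdemM d (matA d θ) θ j = 0) ∧
    (∀ i ≤ d, ∀ j ≤ d,
      ((i : ℤ) = (j : ℤ) + 1 ∨ (j : ℤ) = (i : ℤ) + (d : ℤ)) →
      primIdemM d (matA d θ) θ i * matAs d θs φ * primIdemM d (matA d θ) θ j ≠ 0) ∧
    (∀ i ≤ d, ∀ j ≤ d,
      ((j : ℤ) + 1 < (i : ℤ) ∨ (1 < (j : ℤ) - (i : ℤ) ∧ (j : ℤ) - (i : ℤ) < (d : ℤ))) →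
      primIdemM d (matAs d θs φ) θs i * matA d θ * primIdemM d (matAs d θs φ) θs j = 0) ∧
    (∀ i ≤ d, ∀ j ≤ d,
      ((i : ℤ) = (j : ℤ) + 1 ∨ (j : ℤ) = (i : ℤ) + (d : ℤ)) →
      primIdemM d (matAs d θs φ) θs i * matA d θ * primIdemM d (matAs d θs φ) θs j ≠ 0) := by
  obtain ⟨β, hrθ, hrθs, hv⟩ := hrec
  have hhalf := circular_hessenberg_half hd hθ hφ hrθ hrθs hv hvth
  have hdual := circular_hessenberg_half (φ := fun i => φ (d - i + 1)) hd hθs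
    (fun i h1 h2 => hφ _ (by omega) (by omega)) hrθs hrθ hv.vth_dual (by
      rw [vth_dual _ _ _ (by omega), vth_dual _ _ _ (by omega), Nat.add_sub_cancel,
        Nat.add_sub_cancel_left]
      exact hvth.symm)
  have hP := isUnit_dualityMatrix hφ
  set P := dualityMatrix d φ
  have hconj : ∀ i j, primIdemM d (matAs d θs φ) θs i * matA d θ *
      primIdemM d (matAs d θs φ) θs j * P =
      P * (primIdemM d (matA d θs) θs i * matAs d θ (fun i => φ (d - i + 1)) *
        primIdemM d (matA d θs) θs j) := fun i j => by
    rw [mul_assoc, primIdemM_mul_of_intertwine (matAs_mul_dualityMatrix θs φ), ← mul_assoc,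
      mul_assoc _ (matA d θ), matA_mul_dualityMatrix, ← mul_assoc,
      primIdemM_mul_of_intertwine (matAs_mul_dualityMatrix θs φ)]
    simp only [mul_assoc, P]
  have hzero : ∀ i j, primIdemM d (matAs d θs φ) θs i * matA d θ *
      primIdemM d (matAs d θs φ) θs j = 0 ↔
      primIdemM d (matA d θs) θs i * matAs d θ (fun i => φ (d - i + 1)) *
        primIdemM d (matA d θs) θs j = 0 := fun i j => by
    rw [← hP.mul_left_eq_zero, hconj, hP.mul_right_eq_zero]
  refine ⟨hhalf.1, hhalf.2, fun i hi j hj hij => ?_, fun i hi j hj hij => ?_⟩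
  · exact (hzero i j).2 (hdual.1 i hi j hj hij)
  · exact fun h => hdual.2 i hi j hj hij ((hzero i j).1 h)
end

section
/- Let A, A* ∈ End(V), let {θ_i}_{i=0}^d and {θ*_i}_{i=0}^d be scalars in F, and let {U_i}_{i=0}^d be one-dimensional subspaces of V with V = U_0 ⊕ U_1 ⊕ ⋯ ⊕ U_d, satisfying (A − θ_{d−i}I)U_i = U_{i+1} for 0 ≤ i ≤ d−1, (A − θ_0I)U_d = 0, (A* − θ*_iI)U_i = U_{i−1} for 1 ≤ i ≤ d, and (A* − θ*_0I)U_0 = 0. For 1 ≤ i ≤ d let φ_i ∈ F denote the scalar by which the operator (A − θ_{d−i+1}I)(A* − θ*_iI) acts on U_i (this operator maps U_i into itself and acts there as a nonzero scalar). Fix a nonzero vector u* ∈ U_0 and define v_i = (A − θ_{d−i+1}I)(A − θ_{d−i+2}I)⋯(A − θ_dI)u* for 0 ≤ i ≤ d (so v_0 = u*). Then {v_i}_{i=0}^d is a basis of V with v_i ∈ U_i, and: A v_i = θ_{d−i} v_i + v_{i+1} for 0 ≤ i ≤ d−1; A v_d = θ_0 v_d; A* v_0 = θ*_0 v_0; and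 A* v_i = θ*_i v_i + φ_i v_{i−1} for 1 ≤ i ≤ d. -/
open Polynomial Finset Module

/-- the split decomposition gives rise to a split basis, on which
`A` and `A*` act in the prescribed (bidiagonal) way. -/
theorem stmt3 {F V : Type*} [Field F] [AddCommGroup V] [Module F V]
    (d : ℕ) (hd : 3 ≤ d) (hdim : Module.finrank F V = d + 1)
    (A As : Module.End F V) (θ θs : ℕ → F) (U : ℕ → Submodule F V)
    (hU1 : ∀ i ≤ d, Module.finrank F (U i) = 1)
    (hindep : iSupIndep (fun i : Fin (d+1) => U (i : ℕ)))
    (hspan : (⨆ i : Fin (d+1), U (i : ℕ)) = ⊤)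
    (hA : ∀ i < d, Submodule.map (A - θ (d - i) • 1) (U i) = U (i+1))
    (hAd : ∀ u ∈ U d, (A - θ 0 • 1) u = 0)
    (hAs : ∀ i, 1 ≤ i → i ≤ d → Submodule.map (As - θs i • 1) (U i) = U (i-1))
    (hAs0 : ∀ u ∈ U 0, (As - θs 0 • 1) u = 0)
    (φ : ℕ → F)
    (hφ : ∀ i, 1 ≤ i → i ≤ d → ∀ u ∈ U i,
      ((A - θ (d - i + 1) • 1) * (As - θs i • 1)) u = φ i • u)
    (ustar : V) (hustar : ustar ∈ U 0) (hustar0 : ustar ≠ 0)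
    (v : ℕ → V)
    (hv : ∀ i ≤ d, v i = Polynomial.aeval A
      (∏ k ∈ Finset.Icc (d - i + 1) d, (Polynomial.X - Polynomial.C (θ k))) ustar) :
    LinearIndependent F (fun i : Fin (d+1) => v (i : ℕ)) ∧
    Submodule.span F (v '' Set.Iic d) = ⊤ ∧
    (∀ i ≤ d, v i ∈ U i) ∧
    (∀ i < d, A (v i) = θ (d - i) • v i + v (i+1)) ∧
    A (v d) = θ 0 • v d ∧
    As (v 0) = θs 0 • v 0 ∧
    (∀ i, 1 ≤ i → i ≤ d → As (v i) = θs i • v i + φ i • v (i-1)) := by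
  have hstep : ∀ i < d, v (i + 1) = (A - θ (d - i) • 1) (v i) := by
    intro i hi
    have hIcc : Finset.Icc (d - (i + 1) + 1) d = insert (d - i) (Finset.Icc (d - i + 1) d) := by
      ext k
      simp only [Finset.mem_Icc, Finset.mem_insert]
      omega
    rw [hv (i + 1) hi, hv i hi.le, hIcc, Finset.prod_insert (by simp), map_mul,
      Module.End.mul_apply]
    simp [Algebra.algebraMap_eq_smul_one]
  have hv0 : v 0 = ustar := by
    rw [hv 0 (Nat.zero_le d)]
    simp
  have hU : ∀ i ≤ d, U i = Submodule.span F {v i} := by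
    intro i
    induction i with
    | zero =>
      intro h
      rw [hv0]
      refine le_antisymm (fun x hx => ?_) (by simpa using hustar)
      obtain ⟨c, hc⟩ := (finrank_eq_one_iff_of_nonzero' (⟨ustar, hustar⟩ : U 0)
        (by simpa using hustar0)).1 (hU1 0 h) ⟨x, hx⟩
      exact Submodule.mem_span_singleton.2 ⟨c, congrArg Subtype.val hc⟩
    | succ i ih =>
      intro h
      rw [← hA i h, ih (by omega), Submodule.map_span, Set.image_singleton, hstep i h]
  have hmem : ∀ i ≤ d, v i ∈ U i := fun i hi =>
    hU i hi ▸ Submodule.mem_span_singleton_self (v i)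
  have hne : ∀ i ≤ d, v i ≠ 0 := by
    intro i hi h0
    have h1 := hU1 i hi
    rw [hU i hi, h0, Submodule.span_zero_singleton, finrank_bot] at h1
    exact zero_ne_one h1
  refine ⟨hindep.linearIndependent _ (fun i => hmem i (by omega)) (fun i => hne i (by omega)),
    ?_, hmem, ?_, ?_, ?_, ?_⟩
  · rw [eq_top_iff, ← hspan, iSup_le_iff]
    intro i
    have hi : (i : ℕ) ≤ d := by omega
    rw [hU i hi]
    exact Submodule.span_mono (Set.singleton_subset_iff.2 ⟨i, hi, rfl⟩)
  · intro i hi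
    simp [hstep i hi]
  · simpa [sub_eq_zero] using hAd (v d) (hmem d le_rfl)
  · simpa [sub_eq_zero] using hAs0 (v 0) (hmem 0 (Nat.zero_le d))
  · intro i h1 hi
    obtain ⟨j, rfl⟩ := Nat.exists_eq_add_of_le' h1
    have hw : (As - θs (j + 1) • 1) (v (j + 1)) ∈ U j :=
      hAs (j + 1) h1 hi ▸ Submodule.mem_map_of_mem (hmem _ hi)
    rw [hU j (by omega)] at hw
    obtain ⟨c, hc⟩ := Submodule.mem_span_singleton.1 hw
    have hφv := hφ (j + 1) h1 hi _ (hmem _ hi)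
    rw [Module.End.mul_apply, ← hc, map_smul, show d - (j + 1) + 1 = d - j by omega,
      ← hstep j hi] at hφv
    rw [smul_left_injective F (hne _ hi) hφv] at hc
    rw [Nat.add_sub_cancel, hc]
    simp
end

section
/- Assume there exists β ∈ F such that the sequences {θ_i}_{i=0}^d, {θ*_i}_{i=0}^d, and {ϑ_i}_{i=0}^{d+1} are each β-recurrent. Then: (i) E_i A* E_j = 0 whenever 1 < j−i < d (0 ≤ i,j ≤ d); (ii) E*_i A E*_j = 0 whenever 1 < j−i < d (0 ≤ i,j ≤ d); (iii) E_0 A* E_d ≠ 0 if and only if ϑ_1 ≠ ϑ_d; (iv) E*_0 A E*_d ≠ 0 if and only if ϑ_1 ≠ ϑ_d. -/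
open Polynomial Finset

/-- The sequence with initial terms `x, y, z` that is `β`-recurrent on all of `ℕ`. -/
def recurrentSeq {F : Type*} [Field F] (β x y z : F) : ℕ → F
  | 0 => x
  | 1 => y
  | 2 => z
  | n + 3 => recurrentSeq β x y z n - (β + 1) * recurrentSeq β x y z (n + 1) +
      (β + 1) * recurrentSeq β x y z (n + 2)

section Recurrence

variable {F : Type*} [Field F] {β : F}

lemma recurrentSeq_rec (β x y z : F) (n : ℕ) :
    recurrentSeq β x y z n - (β + 1) * recurrentSeq β x y z (n + 1) +
      (β + 1) * recurrentSeq β x y z (n + 2) - recurrentSeq β x y z (n + 3) = 0 := by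
  rw [recurrentSeq]; ring

lemma BetaRecurrent.apply_add {n : ℕ} {σ : ℕ → F} (h : BetaRecurrent β n σ) {k : ℕ}
    (hk : k + 3 ≤ n) :
    σ k - (β + 1) * σ (k + 1) + (β + 1) * σ (k + 2) - σ (k + 3) = 0 := by
  simpa using h (k + 2) (by omega) (by omega)

lemma BetaRecurrent.reverse {n : ℕ} {σ : ℕ → F} (h : BetaRecurrent β n σ) :
    BetaRecurrent β n fun i => σ (n - i) := by
  intro i hi hin
  have := h.apply_add (k := n - (i + 1)) (by omega)
  rw [show n - (i + 1) + 1 = n - i by omega, show n - (i + 1) + 2 = n - (i - 1) by omega,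
    show n - (i + 1) + 3 = n - (i - 2) by omega] at this
  linear_combination -this

lemma BetaRecurrent.congr {n : ℕ} {σ τ : ℕ → F} (h : BetaRecurrent β n σ)
    (hστ : ∀ i ≤ n, τ i = σ i) : BetaRecurrent β n τ := by
  intro i hi hin
  rw [hστ _ (by omega), hστ _ (by omega), hστ _ (by omega), hστ _ (by omega)]
  exact h i hi hin

lemma BetaRecurrent.eq_recurrentSeq {n : ℕ} {σ : ℕ → F} (h : BetaRecurrent β n σ) :
    ∀ k ≤ n, recurrentSeq β (σ 0) (σ 1) (σ 2) k = σ k := by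
  intro k
  induction k using Nat.strong_induction_on with
  | _ k ih =>
    intro hk
    match k with
    | 0 => rfl
    | 1 => rfl
    | 2 => rfl
    | k + 3 =>
      rw [recurrentSeq, ih k (by omega) (by omega), ih (k + 1) (by omega) (by omega),
        ih (k + 2) (by omega) (by omega)]
      linear_combination h.apply_add hk

/-- A `β`-recurrent sequence extends to the whole of `ℕ` with one new term in front. -/
lemma BetaRecurrent.exists_extension {n : ℕ} {σ : ℕ → F}
    (h : BetaRecurrent β n σ) :
    ∃ τ : ℕ → F, (∀ k ≤ n, τ (k + 1) = σ k) ∧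
      ∀ k, τ k - (β + 1) * τ (k + 1) + (β + 1) * τ (k + 2) - τ (k + 3) = 0 := by
  set σ' : ℕ → F := fun k =>
    if k = 0 then (β + 1) * σ 0 - (β + 1) * σ 1 + σ 2 else σ (k - 1) with hσ'
  have h' : BetaRecurrent β (n + 1) σ' := by
    intro i hi hin
    obtain ⟨k, rfl⟩ := Nat.exists_eq_add_of_le' hi
    rcases k with _ | k
    · simp [hσ']; ring
    · simpa [hσ'] using h.apply_add (k := k) (by omega)
  refine ⟨recurrentSeq β (σ' 0) (σ' 1) (σ' 2), fun k hk => ?_, recurrentSeq_rec _ _ _ _⟩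
  rw [h'.eq_recurrentSeq _ (by omega)]
  simp [hσ']

lemma BetaRecurrent.exists_invariant {n : ℕ} {σ : ℕ → F} (h : BetaRecurrent β n σ) :
    ∃ γ : F, ∀ k, k + 2 ≤ n → σ k - β * σ (k + 1) + σ (k + 2) = γ := by
  refine ⟨σ 0 - β * σ 1 + σ 2, fun k => ?_⟩
  induction k with
  | zero => intro _; rfl
  | succ k ih => intro hk; linear_combination ih (by omega) - h.apply_add hk

/-- First integrals of the `β`-recurrence. -/
lemma exists_invariants {τ : ℕ → F}
    (h : ∀ k, τ k - (β + 1) * τ (k + 1) + (β + 1) * τ (k + 2) - τ (k + 3) = 0) :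
    ∃ γ ρ : F, (∀ k, τ k - β * τ (k + 1) + τ (k + 2) = γ) ∧
      ∀ k, τ k ^ 2 - β * τ k * τ (k + 1) + τ (k + 1) ^ 2 - γ * (τ k + τ (k + 1)) = ρ := by
  have hγ : ∀ k, τ k - β * τ (k + 1) + τ (k + 2) = τ 0 - β * τ 1 + τ 2 := by
    intro k
    induction k with
    | zero => rfl
    | succ k ih => linear_combination ih - h k
  refine ⟨_, _, hγ, fun k => (?_ : _ =
    τ 0 ^ 2 - β * τ 0 * τ 1 + τ 1 ^ 2 - (τ 0 - β * τ 1 + τ 2) * (τ 0 + τ 1))⟩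
  induction k with
  | zero => rfl
  | succ k ih => linear_combination ih + (τ (k + 2) - τ k) * hγ k

/-- The `β`-recurrent sequence `0, 0, 1, …`, whose terms play the role of `q`-binomial
coefficients `[n choose 2]`. -/
def recurrentChoose (β : F) : ℕ → F := recurrentSeq β 0 0 1

lemma recurrentChoose_add_two (β : F) (n : ℕ) :
    recurrentChoose β (n + 2) = β * recurrentChoose β (n + 1) - recurrentChoose β n + 1 := by
  induction n with
  | zero => simp [recurrentChoose, recurrentSeq]
  | succ n ih =>
    have := recurrentSeq_rec β 0 0 1 n
    unfold recurrentChoose at *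
    linear_combination ih - this

lemma recurrentChoose_mul (β : F) (n : ℕ) :
    recurrentChoose β n * recurrentChoose β (n + 2) =
      recurrentChoose β (n + 1) ^ 2 - recurrentChoose β (n + 1) := by
  induction n with
  | zero => simp [recurrentChoose, recurrentSeq]
  | succ n ih =>
    have h1 := recurrentChoose_add_two β n
    have h2 := recurrentChoose_add_two β (n + 1)
    rw [show n + 1 + 2 = n + 3 from rfl] at *
    rw [show n + 1 + 1 = n + 2 from rfl] at *
    linear_combination ih + recurrentChoose β (n + 1) * h2 - recurrentChoose β (n + 2) * h1

/-- A recurrent sequence in terms of its invariant and its first two terms. -/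
lemma eq_recurrentChoose {σ : ℕ → F} {γ : F} {n : ℕ}
    (hσ : ∀ k, k + 2 ≤ n → σ k - β * σ (k + 1) + σ (k + 2) = γ) :
    ∀ k, k + 1 ≤ n → σ (k + 1) = γ * recurrentChoose β (k + 1) -
      σ 0 * (recurrentChoose β (k + 1) - recurrentChoose β k) +
      σ 1 * (recurrentChoose β (k + 2) - recurrentChoose β (k + 1)) := by
  intro k
  induction k using Nat.strong_induction_on with
  | _ k ih =>
    intro hk
    match k with
    | 0 => simp [recurrentChoose, recurrentSeq]
    | 1 =>
      have := hσ 0 (by omega)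
      simp [recurrentChoose, recurrentSeq] at *
      linear_combination this
    | k + 2 =>
      have h1 := ih k (by omega) (by omega)
      have h2 := ih (k + 1) (by omega) (by omega)
      have h3 := hσ (k + 1) (by omega)
      have r0 := recurrentChoose_add_two β k
      have r1 := recurrentChoose_add_two β (k + 1)
      have r2 := recurrentChoose_add_two β (k + 2)
      simp only [add_assoc, Nat.reduceAdd] at *
      linear_combination h3 - h1 + β * h2 - γ * r1 + σ 0 * (r1 - r0) - σ 1 * (r2 - r1)

lemma sub_mul_recurrentChoose {σ : ℕ → F} {γ : F} {n : ℕ}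
    (hσ : ∀ k, k + 2 ≤ n → σ k - β * σ (k + 1) + σ (k + 2) = γ) (k : ℕ) (hk : k + 1 ≤ n) :
    (σ (k + 1) - σ 0) * recurrentChoose β k = (σ k - σ 1) * recurrentChoose β (k + 1) := by
  induction k with
  | zero => simp [recurrentChoose, recurrentSeq]
  | succ k ih =>
    have h1 := ih (by omega)
    have h2 := eq_recurrentChoose hσ k (by omega)
    have h3 := hσ k (by omega)
    have r := recurrentChoose_add_two β k
    simp only [add_assoc, Nat.reduceAdd] at *
    linear_combination h1 + recurrentChoose β (k + 1) * h3 - h2 - σ (k + 1) * r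

lemma recurrentChoose_ne_zero {σ : ℕ → F} {γ : F} {n : ℕ}
    (hσ : ∀ k, k + 2 ≤ n → σ k - β * σ (k + 1) + σ (k + 2) = γ)
    (hinj : ∀ k ≤ n, 0 < k → σ k ≠ σ 0) (k : ℕ) (hk : k + 2 ≤ n) :
    recurrentChoose β (k + 2) ≠ 0 := by
  induction k with
  | zero => simp [recurrentChoose, recurrentSeq]
  | succ k ih =>
    intro h0
    have := sub_mul_recurrentChoose hσ (k + 2) (by omega)
    rw [show k + 2 + 1 = k + 1 + 2 from rfl, h0, mul_zero] at this
    exact mul_ne_zero (sub_ne_zero.2 (hinj _ hk (by omega))) (ih (by omega)) this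

lemma prod_sub_eq_recurrentChoose_mul {γ : F} (n : ℕ) {σ : ℕ → F}
    (hσ : ∀ k, k + 2 ≤ n + 2 → σ k - β * σ (k + 1) + σ (k + 2) = γ) :
    ∏ l ∈ range n, (σ (n + 2) - σ l) =
      recurrentChoose β (n + 2) * ∏ l ∈ range n, (σ (n + 1) - σ (l + 1)) := by
  induction n generalizing σ with
  | zero => simp [recurrentChoose, recurrentSeq]
  | succ n ih =>
    have h1 := ih (σ := fun k => σ (k + 1)) fun k hk => hσ (k + 1) (by omega)
    have h2 := sub_mul_recurrentChoose hσ (n + 2) (by omega)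
    rw [prod_range_succ', prod_range_succ']
    simp only [add_assoc, Nat.reduceAdd, zero_add] at *
    linear_combination (σ (n + 3) - σ 0) * h1 +
      (∏ l ∈ range n, (σ (n + 2) - σ (l + 2))) * h2

/-- The scalar identity behind the value of the corner entry. -/
lemma corner_identity {a ϑ : ℕ → F} {γ δ : F} {n : ℕ}
    (ha : ∀ k, k + 2 ≤ n + 3 → a k - β * a (k + 1) + a (k + 2) = γ)
    (hinj : ∀ k ≤ n + 3, 0 < k → a k ≠ a 0)
    (hϑ : ∀ k, k + 2 ≤ n + 4 → ϑ k - β * ϑ (k + 1) + ϑ (k + 2) = δ) (hlast : ϑ (n + 4) = 0) :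
    (a (n + 2) - a 0) * ϑ (n + 3) + recurrentChoose β (n + 3) *
        ((a (n + 3) - a (n + 2)) * ϑ (n + 2) - (a (n + 3) - a (n + 1)) * ϑ (n + 3)) =
      (a (n + 3) - a (n + 2)) * (ϑ 1 - ϑ (n + 3)) := by
  have hrev : ∀ k, k + 2 ≤ n + 4 →
      ϑ (n + 4 - k) - β * ϑ (n + 4 - (k + 1)) + ϑ (n + 4 - (k + 2)) = δ := by
    intro k hk
    have := hϑ (n + 4 - (k + 2)) (by omega)
    rw [show n + 4 - (k + 2) + 1 = n + 4 - (k + 1) by omega,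
      show n + 4 - (k + 2) + 2 = n + 4 - k by omega] at this
    linear_combination this
  have hone := eq_recurrentChoose (σ := fun k => ϑ (n + 4 - k)) hrev (n + 2) (by omega)
  have hδ := hϑ (n + 2) (by omega)
  have q1 := sub_mul_recurrentChoose ha (n + 2) (by omega)
  have q0 := sub_mul_recurrentChoose ha (n + 1) (by omega)
  have r := recurrentChoose_add_two β (n + 2)
  have m := recurrentChoose_mul β (n + 1)
  have hne := recurrentChoose_ne_zero ha hinj n (by omega)
  simp only [add_assoc, Nat.reduceAdd, Nat.sub_zero,
    show n + 4 - (n + 3) = 1 by omega, show n + 4 - 1 = n + 3 by omega] at *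
  have key : (a (n + 2) - a 0) * (recurrentChoose β (n + 2) - 1) =
      (a (n + 1) - a 1) * recurrentChoose β (n + 3) := by
    refine mul_left_cancel₀ hne ?_
    linear_combination recurrentChoose β (n + 3) * q0 - (a (n + 2) - a 0) * m
  linear_combination (a (n + 3) - a (n + 2)) * (recurrentChoose β (n + 3) * hδ - hone -
    ϑ (n + 3) * r - recurrentChoose β (n + 2) * hlast) + ϑ (n + 3) * (q1 - key)

end Recurrence

/-- The Lagrange idempotent of `A` for `θ i`, where `θ 0, …, θ d` are the eigenvalues of `A`. -/
noncomputable def lagrangeIdem {F R : Type*} [Field F] [Ring R] [Algebra F R] (d : ℕ) (A : R)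
    (θ : ℕ → F) (i : ℕ) : R :=
  aeval A (Lagrange.basis (range (d + 1)) θ i)

section LagrangeIdem

variable {F R : Type*} [Field F] [Ring R] [Algebra F R] {d : ℕ} {A : R} {θ : ℕ → F}

lemma mul_lagrangeIdem (hA : aeval A (∏ j ∈ range (d + 1), (X - C (θ j))) = 0) {i : ℕ}
    (hi : i ≤ d) : A * lagrangeIdem d A θ i = θ i • lagrangeIdem d A θ i := by
  have h : (X - C (θ i)) * Lagrange.basis (range (d + 1)) θ i =
      (∏ j ∈ (range (d + 1)).erase i, C (θ i - θ j)⁻¹) *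
        ∏ j ∈ range (d + 1), (X - C (θ j)) := by
    rw [← mul_prod_erase _ _ (mem_range.2 (Nat.lt_succ_of_le hi)), Lagrange.basis]
    simp only [Lagrange.basisDivisor, prod_mul_distrib]
    ring
  have h' := congrArg (aeval A) h
  rw [map_mul, map_mul, hA, mul_zero, map_sub, aeval_X, aeval_C, sub_mul, sub_eq_zero,
    ← Algebra.smul_def] at h'
  exact h'

lemma lagrangeIdem_mul (hA : aeval A (∏ j ∈ range (d + 1), (X - C (θ j))) = 0) {i : ℕ}
    (hi : i ≤ d) : lagrangeIdem d A θ i * A = θ i • lagrangeIdem d A θ i := by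
  rw [← mul_lagrangeIdem hA hi, lagrangeIdem]
  nth_rw 2 [← aeval_X (R := F) A]
  nth_rw 3 [← aeval_X (R := F) A]
  rw [← map_mul, ← map_mul, mul_comm]

lemma sum_lagrangeIdem (hθ : ∀ i ≤ d, ∀ j ≤ d, θ i = θ j → i = j) :
    ∑ i ∈ range (d + 1), lagrangeIdem d A θ i = 1 := by
  simp only [lagrangeIdem]
  rw [← map_sum, Lagrange.sum_basis _ nonempty_range_add_one, map_one]
  intro i hi j hj h
  simp only [coe_range, Set.mem_Iio] at hi hj
  exact hθ i (by omega) j (by omega) h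

/-- Sandwiching the tridiagonal relation between two idempotents of `A`. -/
lemma lagrangeIdem_mul_mul_eq_zero (hA : aeval A (∏ j ∈ range (d + 1), (X - C (θ j))) = 0)
    {B : R} {β γ ρ : F}
    (hAB : A * A * A * B - (β + 1) • (A * A * B * A) + (β + 1) • (A * B * A * A) - B * A * A * A -
      γ • (A * A * B - B * A * A) - ρ • (A * B - B * A) = 0) {i j : ℕ} (hi : i ≤ d) (hj : j ≤ d)
    (hne : θ i ≠ θ j)
    (hp : θ i ^ 2 - β * θ i * θ j + θ j ^ 2 - γ * (θ i + θ j) ≠ ρ) :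
    lagrangeIdem d A θ i * B * lagrangeIdem d A θ j = 0 := by
  set P := lagrangeIdem d A θ i
  set Q := lagrangeIdem d A θ j
  have hP : P * A = θ i • P := lagrangeIdem_mul hA hi
  have hQ : A * Q = θ j • Q := mul_lagrangeIdem hA hj
  have hP' (Z : R) : P * (A * Z) = θ i • (P * Z) := by rw [← mul_assoc, hP, smul_mul_assoc]
  have h := congrArg (fun Z => P * Z * Q) hAB
  simp only [mul_assoc, mul_add, mul_sub, add_mul, sub_mul, mul_smul_comm, smul_mul_assoc, hP', hQ,
    mul_zero, zero_mul] at h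
  have h' : ((θ i - θ j) * (θ i ^ 2 - β * θ i * θ j + θ j ^ 2 - γ * (θ i + θ j) - ρ)) •
      (P * (B * Q)) = 0 := by
    rw [← h]; module
  rw [mul_assoc]
  exact (smul_eq_zero.1 h').resolve_left (mul_ne_zero (sub_ne_zero.2 hne) (sub_ne_zero.2 hp))

end LagrangeIdem

section SplitForm

variable {F V : Type*} [Field F] [AddCommGroup V] [Module F V]

lemma tridiagonal_apply_eq_zero {A B : Module.End F V} {v u₁ u₂ u₃ u₄ : V}
    {β γ ρ a₀ a₁ a₂ a₃ b₁ b₂ b₃ b₄ c₁ c₂ c₃ c₄ : F}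
    (hv : A v = a₀ • v + c₁ • u₁) (hA₁ : A u₁ = a₁ • u₁ + u₂) (hA₂ : A u₂ = a₂ • u₂ + u₃)
    (hA₃ : A u₃ = a₃ • u₃ + u₄) (hB₁ : B u₁ = b₁ • u₁ + v) (hB₂ : B u₂ = b₂ • u₂ + c₂ • u₁)
    (hB₃ : B u₃ = b₃ • u₃ + c₃ • u₂) (hB₄ : B u₄ = b₄ • u₄ + c₄ • u₃)
    (hγ₁ : a₀ - β * a₁ + a₂ = γ) (hγ₂ : a₁ - β * a₂ + a₃ = γ)
    (hρ₀ : a₀ ^ 2 - β * a₀ * a₁ + a₁ ^ 2 - γ * (a₀ + a₁) = ρ)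
    (hρ₁ : a₁ ^ 2 - β * a₁ * a₂ + a₂ ^ 2 - γ * (a₁ + a₂) = ρ)
    (hb : b₁ - (β + 1) * b₂ + (β + 1) * b₃ - b₄ = 0)
    (hc : u₃ = 0 ∨ c₁ - (β + 1) * c₂ + (β + 1) * c₃ - c₄ =
      b₁ * a₀ - (β + 1) * (b₂ * a₁) + (β + 1) * (b₃ * a₂) - b₄ * a₃) :
    (A * A * A * B - (β + 1) • (A * A * B * A) + (β + 1) • (A * B * A * A) - B * A * A * A -
      γ • (A * A * B - B * A * A) - ρ • (A * B - B * A)) u₁ = 0 := by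
  have hc' : (c₁ - (β + 1) * c₂ + (β + 1) * c₃ - c₄ -
      (b₁ * a₀ - (β + 1) * (b₂ * a₁) + (β + 1) * (b₃ * a₂) - b₄ * a₃)) • u₃ = 0 := by
    rcases hc with h | h <;> simp [h]
  simp only [Module.End.mul_apply, LinearMap.add_apply, LinearMap.sub_apply, LinearMap.smul_apply,
    hA₁, hA₂, hA₃, hB₁, hB₂, hB₃, hB₄, hv, map_add, map_smul]
  rw [← hc']
  match_scalars
  · linear_combination c₁ * hρ₀ - c₂ * hρ₁
  · linear_combination (b₁ - b₂) * hρ₁ + c₁ * hγ₁ - c₃ * hγ₂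
  · linear_combination b₁ * hγ₁ - b₃ * hγ₂ + a₃ * hb
  · linear_combination hb
  · linear_combination (a₀ - a₁) * hρ₀

/-- The pair `A, B` acts on the basis `e 0, …, e d` through the bidiagonal matrices with
parameters `θ`, `θs`, `φ`. -/
structure IsSplitForm (d : ℕ) (θ θs φ : ℕ → F) (A B : Module.End F V) (e : ℕ → V) : Prop where
  apply_left : ∀ k ≤ d, A (e k) = θ (d - k) • e k + e (k + 1)
  apply_right_zero : B (e 0) = θs 0 • e 0
  apply_right_succ : ∀ k < d, B (e (k + 1)) = θs (k + 1) • e (k + 1) + φ (k + 1) • e k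
  eq_zero : ∀ k, d < k → e k = 0
  ne_zero : e d ≠ 0
  ext_zero : ∀ f : Module.End F V, (∀ k ≤ d, f (e k) = 0) → f = 0

namespace IsSplitForm

variable {d : ℕ} {θ θs φ : ℕ → F} {A B : Module.End F V} {e : ℕ → V} {β : F}

lemma aeval_prod_eq_zero (h : IsSplitForm d θ θs φ A B e) :
    aeval A (∏ j ∈ range (d + 1), (X - C (θ j))) = 0 := by
  have key : ∀ m ≤ d + 1, aeval A (∏ j ∈ range m, (X - C (θ j))) (e (d + 1 - m)) = 0 := by
    intro m
    induction m with
    | zero => intro _; simp [h.eq_zero (d + 1)]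
    | succ m ih =>
      intro hm
      rw [prod_range_succ, map_mul, Module.End.mul_apply]
      have : aeval A (X - C (θ m)) (e (d + 1 - (m + 1))) = e (d + 1 - m) := by
        simp only [map_sub, aeval_X, aeval_C, LinearMap.sub_apply, Module.algebraMap_end_apply]
        rw [h.apply_left _ (by omega), show d - (d + 1 - (m + 1)) = m by omega,
          show d + 1 - (m + 1) + 1 = d + 1 - m by omega, add_sub_cancel_left]
      rw [this, ih (by omega)]
  refine h.ext_zero _ fun k hk => ?_
  have hsub : range (d + 1 - k) ⊆ range (d + 1) := range_subset_range.2 (by omega)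
  have := key (d + 1 - k) (by omega)
  rw [show d + 1 - (d + 1 - k) = k by omega] at this
  rw [← prod_sdiff hsub, map_mul, Module.End.mul_apply, this, map_zero]

lemma lagrangeIdem_apply (h : IsSplitForm d θ θs φ A B e) {i k : ℕ} (hi : i ≤ d) (hk : k ≤ d + 1) :
    lagrangeIdem d A θ i (e k) =
      (∏ l ∈ range k, (θ i - θ (d - l))) • lagrangeIdem d A θ i (e 0) := by
  induction k with
  | zero => simp
  | succ k ih =>
    have h1 : lagrangeIdem d A θ i (A (e k)) = θ i • lagrangeIdem d A θ i (e k) :=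
      LinearMap.congr_fun (lagrangeIdem_mul h.aeval_prod_eq_zero hi) (e k)
    rw [h.apply_left k (by omega), map_add, map_smul] at h1
    rw [prod_range_succ, mul_comm, mul_smul, ← ih (by omega), sub_smul, ← h1, add_sub_cancel_left]

/-- An idempotent fixes the eigenvectors of its own eigenvalue. -/
lemma lagrangeIdem_apply_eigenvector (h : IsSplitForm d θ θs φ A B e)
    (hθ : ∀ i ≤ d, ∀ j ≤ d, θ i = θ j → i = j) {i : ℕ} (hi : i ≤ d) {u : V}
    (hu : A u = θ i • u) {j : ℕ} (hj : j ≤ d) :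
    lagrangeIdem d A θ j u = if j = i then u else 0 := by
  have hzero : ∀ j ≤ d, j ≠ i → lagrangeIdem d A θ j u = 0 := by
    intro j hj hne
    have h1 : lagrangeIdem d A θ j (A u) = θ j • lagrangeIdem d A θ j u :=
      LinearMap.congr_fun (lagrangeIdem_mul h.aeval_prod_eq_zero hj) u
    rw [hu, map_smul, ← sub_eq_zero, ← sub_smul, smul_eq_zero, sub_eq_zero] at h1
    exact h1.resolve_left fun h2 => hne (hθ i hi j hj h2).symm
  split_ifs with hji
  · subst hji
    have h1 := LinearMap.congr_fun (sum_lagrangeIdem (A := A) hθ) u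
    rw [LinearMap.sum_apply, sum_eq_single_of_mem j (mem_range.2 (by omega))] at h1
    · exact h1
    · intro l hl hne
      exact hzero l (by simpa [Nat.lt_succ_iff] using hl) hne
  · exact hzero j hj hji

lemma tridiagonal_eq_zero (h : IsSplitForm d θ θs φ A B e) {a : ℕ → F} {γ ρ : F}
    (ha : ∀ k ≤ d, a (k + 1) = θ (d - k))
    (hθs : BetaRecurrent β d θs) (hϑ : BetaRecurrent β (d + 1) (vth d θ θs φ))
    (haγ : ∀ k, a k - β * a (k + 1) + a (k + 2) = γ)
    (haρ : ∀ k, a k ^ 2 - β * a k * a (k + 1) + a (k + 1) ^ 2 - γ * (a k + a (k + 1)) = ρ) :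
    A * A * A * B - (β + 1) • (A * A * B * A) + (β + 1) • (A * B * A * A) - B * A * A * A -
      γ • (A * A * B - B * A * A) - ρ • (A * B - B * A) = 0 := by
  obtain ⟨b', hb', hbrec'⟩ := hθs.exists_extension
  set b : ℕ → F := fun k => b' (k + 1)
  have hb : ∀ k ≤ d, b k = θs k := hb'
  have hbrec : ∀ k, b k - (β + 1) * b (k + 1) + (β + 1) * b (k + 2) - b (k + 3) = 0 :=
    fun k => hbrec' (k + 1)
  set c : ℕ → F := fun k => if 1 ≤ k ∧ k ≤ d then φ k else 0 with hc_def
  have hc : ∀ k ≤ d + 1, c k = vth d θ θs φ k + (b k - b 0) * (a k - a (d + 1)) := by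
    intro k hk
    rcases k with _ | k
    · simp [hc_def, vth]
    rcases eq_or_lt_of_le hk with hk' | hk'
    · simp [hc_def, vth, hk']
    · rw [ha k (by omega), ha d le_rfl, hb _ (by omega), hb 0 (by omega), Nat.sub_self]
      simp only [hc_def, vth]
      rw [if_pos ⟨by omega, by omega⟩, if_pos ⟨by omega, by omega⟩,
        show d - (k + 1) + 1 = d - k by omega]
      ring
  have hA : ∀ k, A (e k) = a (k + 1) • e k + e (k + 1) := by
    intro k
    by_cases hk : k ≤ d
    · rw [ha k hk, h.apply_left k hk]
    · simp [h.eq_zero k (by omega), h.eq_zero (k + 1) (by omega)]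
  have hB : ∀ k, B (e (k + 1)) = b (k + 1) • e (k + 1) + c (k + 1) • e k := by
    intro k
    by_cases hk : k < d
    · rw [hb _ (by omega), h.apply_right_succ k hk]
      simp only [hc_def]
      rw [if_pos ⟨by omega, by omega⟩]
    · have : ¬ k + 1 ≤ d := by omega
      simp [h.eq_zero (k + 1) (by omega), hc_def, this]
  refine h.ext_zero _ fun k hk => ?_
  have hthird : e (k + 2) = 0 ∨ c k - (β + 1) * c (k + 1) + (β + 1) * c (k + 2) - c (k + 3) =
      b k * a k - (β + 1) * (b (k + 1) * a (k + 1)) + (β + 1) * (b (k + 2) * a (k + 2)) -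
        b (k + 3) * a (k + 3) := by
    by_cases hk2 : k + 2 ≤ d
    · right
      rw [hc _ (by omega), hc _ (by omega), hc _ (by omega), hc _ (by omega)]
      linear_combination hϑ.apply_add (k := k) (by omega) - a (d + 1) * hbrec k -
        b 0 * (haγ k - haγ (k + 1))
    · exact Or.inl (h.eq_zero _ (by omega))
  obtain ⟨v, hv, hBv⟩ : ∃ v, A v = a k • v + c k • e k ∧ B (e k) = b k • e k + v := by
    rcases k with _ | k
    · refine ⟨0, ?_, ?_⟩
      · simp [hc_def]
      · rw [h.apply_right_zero, hb 0 (by omega), add_zero]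
    · refine ⟨c (k + 1) • e k, ?_, hB k⟩
      rw [map_smul, hA]
      module
  exact tridiagonal_apply_eq_zero hv (hA k) (hA (k + 1)) (hA (k + 2)) hBv (hB k) (hB (k + 1))
    (hB (k + 2)) (haγ k) (haγ (k + 1)) (haρ k) (haρ (k + 1)) (hbrec k) hthird

/-- The products `E i * B * E j` vanish above the superdiagonal, except in the corner. -/
lemma lagrangeIdem_mul_mul_eq_zero (h : IsSplitForm d θ θs φ A B e)
    (hinj : ∀ i ≤ d, ∀ j ≤ d, θ i = θ j → i = j) (hθ : BetaRecurrent β d θ)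
    (hθs : BetaRecurrent β d θs) (hϑ : BetaRecurrent β (d + 1) (vth d θ θs φ)) {i j : ℕ}
    (hj : j ≤ d) (hij : i + 1 < j) (hijd : j < i + d) :
    lagrangeIdem d A θ i * B * lagrangeIdem d A θ j = 0 := by
  obtain ⟨a, ha, harec⟩ := hθ.reverse.exists_extension
  obtain ⟨γ, ρ, haγ, haρ⟩ := exists_invariants harec
  have hθa : ∀ m ≤ d, θ m = a (d - m + 1) := by
    intro m hm
    rw [ha _ (by omega), show d - (d - m) = m by omega]
  have hγ : ∀ m, m + 2 ≤ d → θ m - β * θ (m + 1) + θ (m + 2) = γ := by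
    intro m hm
    rw [hθa _ (by omega), hθa _ (by omega), hθa _ (by omega), ← haγ (d - (m + 2) + 1),
      show d - (m + 1) + 1 = d - (m + 2) + 1 + 1 by omega,
      show d - m + 1 = d - (m + 2) + 1 + 2 by omega]
    ring
  have hρ : ∀ m, m + 1 ≤ d →
      θ m ^ 2 - β * θ m * θ (m + 1) + θ (m + 1) ^ 2 - γ * (θ m + θ (m + 1)) = ρ := by
    intro m hm
    rw [hθa _ (by omega), hθa _ (by omega), ← haρ (d - (m + 1) + 1),
      show d - m + 1 = d - (m + 1) + 1 + 1 by omega]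
    ring
  have hsub : ∀ m ≤ d, ∀ n ≤ d, m ≠ n → θ m - θ n ≠ 0 := fun m hm n hn hmn h0 =>
    hmn (hinj m hm n hn (sub_eq_zero.1 h0))
  refine _root_.lagrangeIdem_mul_mul_eq_zero h.aeval_prod_eq_zero
    (h.tridiagonal_eq_zero ha hθs hϑ haγ haρ) (by omega) hj
    (sub_ne_zero.1 (hsub i (by omega) j hj (by omega))) fun hp => ?_
  rcases i with _ | i
  · obtain ⟨j, rfl⟩ := Nat.exists_eq_add_of_le' (show 1 ≤ j by omega)
    refine mul_ne_zero (hsub 0 (by omega) j (by omega) (by omega))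
      (hsub 0 (by omega) (j + 2) (by omega) (by omega)) ?_
    linear_combination hp - hρ j (by omega) - (θ 0 - θ j) * hγ j (by omega)
  · refine mul_ne_zero (hsub j hj i (by omega) (by omega))
      (hsub j hj (i + 2) (by omega) (by omega)) ?_
    linear_combination hp - hρ i (by omega) - (θ j - θ i) * hγ i (by omega)

/-- The corner product `E 0 * B * E d` evaluated at `e 0`. -/
lemma sub_smul_corner_apply (h : IsSplitForm d θ θs φ A B e) (hd : 3 ≤ d)
    (hinj : ∀ i ≤ d, ∀ j ≤ d, θ i = θ j → i = j) (hθ : BetaRecurrent β d θ)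
    (hθs : BetaRecurrent β d θs) (hϑ : BetaRecurrent β (d + 1) (vth d θ θs φ)) :
    (θ d - θ 1) • (lagrangeIdem d A θ 0 * B * lagrangeIdem d A θ d) (e 0) =
      (vth d θ θs φ 1 - vth d θ θs φ d) • lagrangeIdem d A θ 0 (e 0) := by
  have hzero := fun j hj hj1 hjd =>
    h.lagrangeIdem_mul_mul_eq_zero hinj hθ hθs hϑ (i := 0) (j := j) hj hj1 hjd
  obtain ⟨γ, ha⟩ := hθ.reverse.exists_invariant
  obtain ⟨δ, hδ⟩ := hϑ.exists_invariant
  obtain ⟨n, rfl⟩ := Nat.exists_eq_add_of_le' hd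
  have hsub : ∀ m ≤ n + 3, ∀ l ≤ n + 3, m ≠ l → θ m - θ l ≠ 0 := fun m hm l hl hml h0 =>
    hml (hinj m hm l hl (sub_eq_zero.1 h0))
  have hcorner := corner_identity (a := fun k => θ (n + 3 - k)) ha
    (fun k hk hk0 => sub_ne_zero.1 (hsub _ (by omega) _ (by omega) (by omega))) hδ
    (by simp [vth])
  have hprod := prod_sub_eq_recurrentChoose_mul (n + 1) (σ := fun k => θ (n + 3 - k)) ha
  set P := ∏ l ∈ range (n + 1), (θ 1 - θ (n + 3 - (l + 1))) with hP
  have hP0 : P ≠ 0 := by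
    refine prod_ne_zero_iff.2 fun l hl => hsub _ (by omega) _ (by omega) ?_
    have := mem_range.1 hl
    omega
  set E := lagrangeIdem (n + 3) A θ
  set x := E 0 (e 0)
  set w : ℕ → F := fun k => ∏ l ∈ range k, (θ 0 - θ (n + 3 - l))
  have hw0 : ∀ k ≤ n + 3, w k ≠ 0 := by
    intro k hk
    refine prod_ne_zero_iff.2 fun l hl => hsub _ (by omega) _ (by omega) ?_
    have := mem_range.1 hl
    omega
  have hE0 : ∀ k ≤ n + 4, E 0 (e k) = w k • x := fun k hk => h.lagrangeIdem_apply (by omega) hk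
  have hφ : ∀ k ≤ n + 2, φ (k + 1) = vth (n + 3) θ θs φ (k + 1) +
      (θs (k + 1) - θs 0) * (θ (n + 3 - k) - θ 0) := by
    intro k hk
    rw [vth, if_pos ⟨by omega, by omega⟩, show n + 3 - (k + 1) + 1 = n + 3 - k by omega]
    ring
  have hEB : ∀ k ≤ n + 2, E 0 (B (e (k + 1))) =
      (w k * (vth (n + 3) θ θs φ (k + 1) + θs 0 * (θ 0 - θ (n + 3 - k)))) • x := by
    intro k hk
    have hws : w (k + 1) = w k * (θ 0 - θ (n + 3 - k)) := prod_range_succ _ _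
    rw [h.apply_right_succ k (by omega), map_add, map_smul, map_smul, hE0 _ (by omega),
      hE0 _ (by omega), hφ k hk, hws]
    module
  have hAd : A (e (n + 3)) = θ 0 • e (n + 3) := by
    rw [h.apply_left _ le_rfl, h.eq_zero (n + 3 + 1) (by omega), add_zero, Nat.sub_self]
  have hxd : w (n + 3) • x = e (n + 3) := by
    rw [← hE0 _ (by omega)]
    simpa using h.lagrangeIdem_apply_eigenvector hinj (Nat.zero_le _) hAd (Nat.zero_le _)
  set u := (θ 1 - θ 0) • e (n + 2) + e (n + 3) with hu
  have hAu : A u = θ 1 • u := by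
    rw [hu, map_add, map_smul, hAd, h.apply_left _ (by omega), show n + 3 - (n + 2) = 1 by omega]
    module
  have hE1 : ((θ 1 - θ 0) * ((θ 1 - θ (n + 3)) * P)) • E 1 (e 0) = u := by
    have h1 : E 1 u = u := by
      simpa using h.lagrangeIdem_apply_eigenvector hinj (by omega) hAu (by omega : 1 ≤ n + 3)
    have h2 : E 1 (e (n + 3)) = 0 := by
      simpa using
        h.lagrangeIdem_apply_eigenvector hinj (Nat.zero_le _) hAd (by omega : 1 ≤ n + 3)
    have h3 : E 1 (e (n + 2)) = _ := h.lagrangeIdem_apply (by omega) (by omega)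
    rw [prod_range_succ', ← hP, Nat.sub_zero] at h3
    rw [← h1, hu, map_add, map_smul, h2, h3, add_zero]
    module
  have hsum : θs 0 • x = E 0 (B x) + E 0 (B (E 1 (e 0))) + (E 0 * B * E (n + 3)) (e 0) := by
    have h1 := LinearMap.congr_fun (sum_lagrangeIdem (A := A) hinj) (e 0)
    rw [LinearMap.sum_apply, sum_range_succ, sum_range_succ', sum_range_succ'] at h1
    have h2 := congrArg (fun z => E 0 (B z)) h1
    simp only [map_add, map_sum, Module.End.one_apply, h.apply_right_zero, map_smul] at h2
    rw [sum_eq_zero, zero_add, add_comm (E 0 (B (E (0 + 1) (e 0))))] at h2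
    · exact h2.symm
    · intro j hj
      have hj' := mem_range.1 hj
      exact LinearMap.congr_fun (hzero (j + 1 + 1) (by omega) (by omega) (by omega)) (e 0)
  have hBx : (θ 0 - θ 1) • E 0 (B x) =
      (vth (n + 3) θ θs φ (n + 3) + θs 0 * (θ 0 - θ 1)) • x := by
    have h1 := hEB (n + 2) le_rfl
    have hws : w (n + 3) = w (n + 2) * (θ 0 - θ (n + 3 - (n + 2))) := prod_range_succ _ _
    rw [← hxd, hws, map_smul, map_smul, mul_smul, mul_smul, show n + 3 - (n + 2) = 1 by omega] at h1
    exact smul_right_injective V (hw0 (n + 2) (by omega)) h1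
  have hBE : (θ 1 - θ (n + 3)) • (θ 1 - θ 0) • E 0 (B (E 1 (e 0))) =
      (recurrentChoose β (n + 3) * ((θ 1 - θ 0) * vth (n + 3) θ θs φ (n + 2) +
        (θ 0 - θ 2) * vth (n + 3) θ θs φ (n + 3))) • x := by
    have h1 := congrArg (fun z => E 0 (B z)) hE1
    have hws : w (n + 2) = w (n + 1) * (θ 0 - θ (n + 3 - (n + 1))) := prod_range_succ _ _
    have hwP : w (n + 1) = recurrentChoose β (n + 3) * P := by
      simpa only [Nat.sub_self, show n + 3 - (n + 1 + 1) = 1 by omega] using hprod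
    simp only [hu, map_add, map_smul] at h1
    rw [hEB (n + 1) (by omega), hEB (n + 2) le_rfl, hws, hwP,
      show n + 3 - (n + 1) = 2 by omega, show n + 3 - (n + 2) = 1 by omega] at h1
    refine smul_right_injective V hP0 ?_
    simp only
    linear_combination (norm := module) h1
  refine smul_right_injective V (hsub 0 (by omega) 1 (by omega) (by omega)) ?_
  simp only [show n + 3 - (n + 2) = 1 by omega, show n + 3 - (n + 1) = 2 by omega, Nat.sub_self,
    Nat.sub_zero] at hcorner ⊢
  linear_combination (norm := module) ((θ 0 - θ 1) * (θ 1 - θ (n + 3))) • hsum +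
    (θ 1 - θ (n + 3)) • hBx - hBE + hcorner • x

/-- The corner product is nonzero precisely when the end values of `vth` differ. -/
lemma corner_ne_zero_iff (h : IsSplitForm d θ θs φ A B e) (hd : 3 ≤ d)
    (hinj : ∀ i ≤ d, ∀ j ≤ d, θ i = θ j → i = j) (hθ : BetaRecurrent β d θ)
    (hθs : BetaRecurrent β d θs) (hϑ : BetaRecurrent β (d + 1) (vth d θ θs φ)) :
    lagrangeIdem d A θ 0 * B * lagrangeIdem d A θ d ≠ 0 ↔
      vth d θ θs φ 1 ≠ vth d θ θs φ d := by
  have hkey := h.sub_smul_corner_apply hd hinj hθ hθs hϑ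
  have hx : lagrangeIdem d A θ 0 (e 0) ≠ 0 := by
    intro h0
    have hAd : A (e d) = θ 0 • e d := by
      rw [h.apply_left _ le_rfl, h.eq_zero (d + 1) (by omega), add_zero, Nat.sub_self]
    have h1 := h.lagrangeIdem_apply_eigenvector hinj (Nat.zero_le _) hAd (Nat.zero_le _)
    rw [h.lagrangeIdem_apply (Nat.zero_le _) (by omega), h0, smul_zero, if_pos rfl] at h1
    exact h.ne_zero h1.symm
  have hsub : θ d - θ 1 ≠ 0 := fun h0 => by
    have := hinj d le_rfl 1 (by omega) (sub_eq_zero.1 h0)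
    omega
  rw [not_iff_not]
  constructor
  · intro h0
    rw [h0, LinearMap.zero_apply, smul_zero, eq_comm, smul_eq_zero] at hkey
    exact sub_eq_zero.1 (hkey.resolve_right hx)
  · intro h0
    rw [h0, sub_self, zero_smul, smul_eq_zero] at hkey
    refine h.ext_zero _ fun k hk => ?_
    have hE := h.lagrangeIdem_apply le_rfl (Nat.le_succ_of_le hk)
    rw [Module.End.mul_apply] at hkey ⊢
    rw [hE, map_smul, hkey.resolve_left hsub, smul_zero]

/-- Reversing the basis and rescaling interchanges the two maps. -/
lemma swap (h : IsSplitForm d θ θs φ A B e) (hφ : ∀ i, 1 ≤ i → i ≤ d → φ i ≠ 0) :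
    IsSplitForm d θs θ (fun i => φ (d + 1 - i)) B A
      (fun k => if k ≤ d then (∏ l ∈ range k, φ (d - l)) • e (d - k) else 0) := by
  have hne : ∀ k ≤ d, ∏ l ∈ range k, φ (d - l) ≠ 0 := by
    intro k hk
    refine prod_ne_zero_iff.2 fun l hl => ?_
    have := mem_range.1 hl
    exact hφ _ (by omega) (by omega)
  refine ⟨fun k hk => ?_, ?_, fun k hk => ?_, fun k hk => if_neg (by omega), ?_, fun f hf => ?_⟩
  · rcases hk.eq_or_lt with rfl | hk
    · simp [h.apply_right_zero, smul_comm (θs 0)]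
    · rw [if_pos (by omega), if_pos (by omega), prod_range_succ, map_smul]
      obtain ⟨m, hm⟩ : ∃ m, d - k = m + 1 := ⟨d - k - 1, by omega⟩
      rw [show d - (k + 1) = m by omega, hm, h.apply_right_succ m (by omega)]
      module
  · simp [h.apply_left d le_rfl, h.eq_zero (d + 1)]
  · rw [if_pos (by omega), if_pos (by omega), prod_range_succ, map_smul,
      h.apply_left _ (by omega), show d - (d - (k + 1)) = k + 1 by omega,
      show d - (k + 1) + 1 = d - k by omega, show d + 1 - (k + 1) = d - k by omega]
    module
  · simp only [le_refl, if_true, Nat.sub_self]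
    refine smul_ne_zero (hne d le_rfl) fun h0 => h.ne_zero ?_
    have : ∀ k ≤ d, e k = 0 := by
      intro k
      induction k with
      | zero => exact fun _ => h0
      | succ k ih =>
        intro hk
        have h1 := h.apply_left k (by omega)
        rwa [ih (by omega), map_zero, smul_zero, zero_add, eq_comm] at h1
    exact this d le_rfl
  · refine h.ext_zero f fun k hk => ?_
    have h1 := hf (d - k) (by omega)
    rw [if_pos (by omega), map_smul, show d - (d - k) = k by omega] at h1
    exact (smul_eq_zero.1 h1).resolve_left (hne _ (by omega))

end IsSplitForm

end SplitForm

section MatrixForm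

variable {F : Type*} [Field F] {d : ℕ}

lemma toLinAlgEquiv'_primIdemM (M : Matrix (Fin (d + 1)) (Fin (d + 1)) F) (θ : ℕ → F) (i : ℕ) :
    Matrix.toLinAlgEquiv' (primIdemM d M θ i) =
      lagrangeIdem d (Matrix.toLinAlgEquiv' M) θ i := by
  unfold primIdemM lagrangeIdem
  rw [← AlgEquiv.coe_toAlgHom, ← aeval_algHom_apply]
  rfl

lemma isSplitForm_mat (θ θs φ : ℕ → F) :
    IsSplitForm d θ θs φ (Matrix.toLinAlgEquiv' (matA d θ)) (Matrix.toLinAlgEquiv' (matAs d θs φ))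
      (fun k i => if (i : ℕ) = k then 1 else 0) := by
  have hmul : ∀ (M : Matrix (Fin (d + 1)) (Fin (d + 1)) F) (k : ℕ) (hk : k < d + 1),
      Matrix.toLinAlgEquiv' M (fun i : Fin (d + 1) => if (i : ℕ) = k then (1 : F) else 0) =
        fun i => M i ⟨k, hk⟩ := by
    intro M k hk
    ext i
    rw [Matrix.toLinAlgEquiv'_apply, Matrix.mulVec, dotProduct,
      sum_eq_single_of_mem ⟨k, hk⟩ (mem_univ _)]
    · simp
    · intro j _ hj
      rw [if_neg fun h => hj (Fin.ext h), mul_zero]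
  refine ⟨fun k hk => ?_, ?_, fun k hk => ?_, fun k hk => ?_, fun h0 => ?_, fun f hf => ?_⟩
  · rw [hmul _ k (by omega)]
    ext i
    by_cases h1 : (i : ℕ) = k
    · simp [matA, h1]
    · simp [matA, h1]
  · rw [hmul _ 0 (by omega)]
    ext i
    by_cases h1 : i = 0
    · simp [matAs, h1]
    · simp [matAs, h1]
  · rw [hmul _ (k + 1) (by omega)]
    ext i
    by_cases h1 : (i : ℕ) = k + 1
    · simp [matAs, h1]
    · simp [matAs, h1, eq_comm (a := k)]
  · ext i
    simp only [Pi.zero_apply, ite_eq_right_iff]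
    omega
  · simpa using congrFun h0 ⟨d, by omega⟩
  · refine (Pi.basisFun F (Fin (d + 1))).ext fun i => ?_
    rw [Pi.basisFun_apply, LinearMap.zero_apply, ← hf i (by omega)]
    congr 1
    ext j
    simp [Pi.single_apply, Fin.ext_iff]

lemma vth_swap (θ θs φ : ℕ → F) {i : ℕ} (hi : i ≤ d + 1) :
    vth d θs θ (fun i => φ (d + 1 - i)) i = vth d θ θs φ (d + 1 - i) := by
  unfold vth
  by_cases h : 1 ≤ i ∧ i ≤ d
  · rw [if_pos h, if_pos ⟨by omega, by omega⟩, show d - i + 1 = d + 1 - i by omega,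
      show d - (d + 1 - i) + 1 = i by omega]
    ring
  · rw [if_neg h, if_neg (by omega)]

end MatrixForm

/-- under the recurrence hypotheses, the entries of `E i A* E j`
(resp. `E* i A E* j`) vanish strictly above the superdiagonal away from the corner,
and the corner products `E 0 A* E d`, `E* 0 A E* d` are nonzero iff `ϑ 1 ≠ ϑ d`. -/
theorem stmt6 {F : Type*} [Field F]
    (d : ℕ) (hd : 3 ≤ d)
    (θ θs φ : ℕ → F)
    (hθ : ∀ i ≤ d, ∀ j ≤ d, θ i = θ j → i = j)
    (hθs : ∀ i ≤ d, ∀ j ≤ d, θs i = θs j → i = j)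
    (hφ : ∀ i, 1 ≤ i → i ≤ d → φ i ≠ 0)
    (hrec : ∃ β : F, BetaRecurrent β d θ ∧ BetaRecurrent β d θs ∧
      BetaRecurrent β (d+1) (vth d θ θs φ)) :
    (∀ i ≤ d, ∀ j ≤ d, 1 < (j : ℤ) - (i : ℤ) → (j : ℤ) - (i : ℤ) < (d : ℤ) →
      primIdemM d (matA d θ) θ i * matAs d θs φ * primIdemM d (matA d θ) θ j = 0) ∧
    (∀ i ≤ d, ∀ j ≤ d, 1 < (j : ℤ) - (i : ℤ) → (j : ℤ) - (i : ℤ) < (d : ℤ) →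
      primIdemM d (matAs d θs φ) θs i * matA d θ * primIdemM d (matAs d θs φ) θs j = 0) ∧
    (primIdemM d (matA d θ) θ 0 * matAs d θs φ * primIdemM d (matA d θ) θ d ≠ 0 ↔
      vth d θ θs φ 1 ≠ vth d θ θs φ d) ∧
    (primIdemM d (matAs d θs φ) θs 0 * matA d θ * primIdemM d (matAs d θs φ) θs d ≠ 0 ↔
      vth d θ θs φ 1 ≠ vth d θ θs φ d) := by
  obtain ⟨β, hrθ, hrθs, hrϑ⟩ := hrec
  have h := isSplitForm_mat (d := d) θ θs φ
  have hrϑ' : BetaRecurrent β (d + 1) (vth d θs θ fun i => φ (d + 1 - i)) :=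
    hrϑ.reverse.congr fun i hi => vth_swap θ θs φ hi
  have hinj (M : Matrix (Fin (d + 1)) (Fin (d + 1)) F) : Matrix.toLinAlgEquiv' M = 0 ↔ M = 0 :=
    map_eq_zero_iff _ Matrix.toLinAlgEquiv'.injective
  simp only [ne_eq, ← hinj, map_mul, toLinAlgEquiv'_primIdemM]
  refine ⟨fun i _ j hj hij hijd => ?_, fun i _ j hj hij hijd => ?_, ?_, ?_⟩
  · exact h.lagrangeIdem_mul_mul_eq_zero hθ hrθ hrθs hrϑ hj (by omega) (by omega)
  · exact (h.swap hφ).lagrangeIdem_mul_mul_eq_zero hθs hrθs hrθ hrϑ' hj (by omega) (by omega)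
  · exact h.corner_ne_zero_iff hd hθ hrθ hrθs hrϑ
  · have hiff := (h.swap hφ).corner_ne_zero_iff hd hθs hrθs hrθ hrϑ'
    rw [vth_swap θ θs φ (by omega), vth_swap θ θs φ (by omega), Nat.add_sub_cancel,
      Nat.add_sub_cancel_left] at hiff
    exact hiff.trans ne_comm
end

section
/- Let A, A* be a circular Hessenberg pair on V. Then each of A and A* is multiplicity-free, i.e., each has d+1 mutually distinct eigenvalues in F (equivalently, each is diagonalizable with all eigenspaces one-dimensional). -/
open Polynomial Module

/-- A matrix is circular Hessenberg: entries below the subdiagonal vanish, the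
subdiagonal entries are nonzero, the upper-right corner entry is nonzero, and all
other entries above the superdiagonal vanish. -/
def IsCircHess {F : Type*} [Field F] (d : ℕ)
    (M : Matrix (Fin (d+1)) (Fin (d+1)) F) : Prop :=
  (∀ i j : Fin (d+1), (j : ℕ) + 1 < (i : ℕ) → M i j = 0) ∧
  (∀ i j : Fin (d+1), (i : ℕ) = (j : ℕ) + 1 → M i j ≠ 0) ∧
  M 0 (Fin.last d) ≠ 0 ∧
  (∀ i j : Fin (d+1), (i : ℕ) + 1 < (j : ℕ) → (j : ℕ) < (i : ℕ) + d → M i j = 0)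

/-- An eigenvector of a Hessenberg endomorphism whose last coordinate vanishes is zero. -/
theorem eq_zero_of_hessenberg_of_last_eq_zero {F V : Type*} [Field F] [AddCommGroup V]
    [Module F V] {d : ℕ} {A : Module.End F V} (b : Basis (Fin (d + 1)) F V)
    (hlow : ∀ i j : Fin (d + 1), (j : ℕ) + 1 < (i : ℕ) → LinearMap.toMatrix b b A i j = 0)
    (hsub : ∀ i j : Fin (d + 1), (i : ℕ) = (j : ℕ) + 1 → LinearMap.toMatrix b b A i j ≠ 0)
    {μ : F} {v : V} (hv : A v = μ • v) (hlast : b.repr v (Fin.last d) = 0) : v = 0 := by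
  have key : ∀ k : ℕ, ∀ i : Fin (d + 1), d ≤ (i : ℕ) + k → b.repr v i = 0 := by
    intro k
    induction k with
    | zero =>
      intro i hi
      have : i = Fin.last d := by
        ext
        simp only [Fin.val_last]
        omega
      rw [this, hlast]
    | succ k ih =>
      intro i hi
      by_cases hik : d ≤ (i : ℕ) + k
      · exact ih i hik
      have hi' : (i : ℕ) + 1 < d + 1 := by omega
      have hrow := congrFun (LinearMap.toMatrix_mulVec_repr b b A v) ⟨(i : ℕ) + 1, hi'⟩
      rw [hv, map_smul, Finsupp.smul_apply, ih ⟨(i : ℕ) + 1, hi'⟩ (by simp only; omega),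
        smul_zero, Matrix.mulVec, dotProduct, Finset.sum_eq_single i] at hrow
      · exact (mul_eq_zero.mp hrow).resolve_left (hsub _ _ rfl)
      · intro j _ hj
        have hj' : (j : ℕ) ≠ i := fun h => hj (Fin.ext h)
        rcases Nat.lt_or_gt_of_ne hj' with h | h
        · rw [hlow _ _ (by simp only; omega), zero_mul]
        · rw [ih j (by omega), mul_zero]
      · simp
  refine b.repr.map_eq_zero_iff.mp (Finsupp.ext fun i => key d i (by omega))

/-- An endomorphism that is diagonal in one basis and Hessenberg in another is
multiplicity-free. -/
theorem multiplicityFree_of_diagonal_of_hessenberg {F V : Type*} [Field F] [AddCommGroup V]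
    [Module F V] {d : ℕ} {A : Module.End F V} (b c : Basis (Fin (d + 1)) F V)
    (hdiag : ∀ i j : Fin (d + 1), i ≠ j → LinearMap.toMatrix b b A i j = 0)
    (hlow : ∀ i j : Fin (d + 1), (j : ℕ) + 1 < (i : ℕ) → LinearMap.toMatrix c c A i j = 0)
    (hsub : ∀ i j : Fin (d + 1), (i : ℕ) = (j : ℕ) + 1 → LinearMap.toMatrix c c A i j ≠ 0) :
    ∃ θ : Fin (d + 1) → F, Function.Injective θ ∧
      (∀ i, Module.End.HasEigenvalue A (θ i)) ∧
      Polynomial.aeval A (∏ i : Fin (d + 1), (Polynomial.X - Polynomial.C (θ i))) = 0 := by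
  have happ : ∀ i, A (b i) = LinearMap.toMatrix b b A i i • b i := by
    intro i
    rw [← b.sum_repr (A (b i)), Finset.sum_eq_single i]
    · rw [LinearMap.toMatrix_apply]
    · intro j _ hj
      rw [← LinearMap.toMatrix_apply, hdiag j i hj, zero_smul]
    · simp
  have hvec : ∀ i, Module.End.HasEigenvector A (LinearMap.toMatrix b b A i i) (b i) := fun i =>
    ⟨Module.End.mem_eigenspace_iff.mpr (happ i), b.ne_zero i⟩
  refine ⟨fun i => LinearMap.toMatrix b b A i i, ?_,
    fun i => Module.End.hasEigenvalue_of_hasEigenvector (hvec i), ?_⟩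
  · intro i j hij
    by_contra hne
    have hzero : c.repr (b j) (Fin.last d) • b i - c.repr (b i) (Fin.last d) • b j = 0 := by
      refine eq_zero_of_hessenberg_of_last_eq_zero c hlow hsub
        (μ := LinearMap.toMatrix b b A i i) ?_ ?_
      · simp only at hij
        rw [map_sub, map_smul, map_smul, happ i, happ j, ← hij, smul_sub,
          smul_comm _ (c.repr (b j) _), smul_comm _ (c.repr (b i) _)]
      · simp [mul_comm]
    have hcoord := congrArg (fun v => b.repr v j) hzero
    have hlast : c.repr (b i) (Fin.last d) = 0 := by
      simpa [Finsupp.single_apply, hne] using hcoord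
    exact b.ne_zero i (eq_zero_of_hessenberg_of_last_eq_zero c hlow hsub (happ i) hlast)
  · refine b.ext fun i => ?_
    rw [Module.End.aeval_apply_of_hasEigenvector (hvec i), Polynomial.eval_prod,
      Finset.prod_eq_zero (Finset.mem_univ i) (by simp), zero_smul, LinearMap.zero_apply]

/-- each member of a circular Hessenberg pair is multiplicity-free, i.e.
has `d+1` mutually distinct eigenvalues in `F` and is annihilated by the corresponding
split squarefree polynomial (equivalently, is diagonalizable with one-dimensional
eigenspaces). -/
theorem stmt8 {F V : Type*} [Field F] [AddCommGroup V] [Module F V]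
    (d : ℕ) (hd : 3 ≤ d) (hdim : Module.finrank F V = d + 1)
    (A As : Module.End F V)
    (h1 : ∃ b : Basis (Fin (d+1)) F V,
      (∀ i j : Fin (d+1), i ≠ j → LinearMap.toMatrix b b A i j = 0) ∧
      IsCircHess d (LinearMap.toMatrix b b As))
    (h2 : ∃ b : Basis (Fin (d+1)) F V,
      (∀ i j : Fin (d+1), i ≠ j → LinearMap.toMatrix b b As i j = 0) ∧
      IsCircHess d (LinearMap.toMatrix b b A)) :
    (∃ θ : Fin (d+1) → F, Function.Injective θ ∧
      (∀ i, Module.End.HasEigenvalue A (θ i)) ∧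
      Polynomial.aeval A (∏ i : Fin (d+1), (Polynomial.X - Polynomial.C (θ i))) = 0) ∧
    (∃ θ : Fin (d+1) → F, Function.Injective θ ∧
      (∀ i, Module.End.HasEigenvalue As (θ i)) ∧
      Polynomial.aeval As (∏ i : Fin (d+1), (Polynomial.X - Polynomial.C (θ i))) = 0) := by
  obtain ⟨b, hb, hbs⟩ := h1
  obtain ⟨c, hc, hcs⟩ := h2
  exact ⟨multiplicityFree_of_diagonal_of_hessenberg b c hb hcs.1 hcs.2.1,
    multiplicityFree_of_diagonal_of_hessenberg c b hc hbs.1 hbs.2.1⟩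
end
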